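/- arXiv:math/0607396 — 4 statements merged into one kernel-verified Lean document; each statement's English description precedes it below -/
import Mathlib

section
/- In a d-braxtope Q^{d,n} with vertex array x_0 < x_1 < ... < x_n (n ≥ d ≥ 3), the segment [x_1, x_u] is an edge of Q if and only if u = 0 or 2 ≤ u ≤ d. -/
open Set

noncomputable section

variable {V : Type*} [NormedAddCommGroup V] [NormedSpace ℝ V]

open Classical in
/-- Affine dimension of a set: `-1` for the empty set, otherwise the
dimension of its affine hull. -/
def sdim (s : Set V) : ℤ :=
  if s.Nonempty then (Module.finrank ℝ (affineSpan ℝ s).direction : ℤ) else -1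

/-- `F` is a face of the polytope `Q`. -/
def IsFaceOf (Q F : Set V) : Prop :=
  IsExtreme ℝ Q F ∧ Convex ℝ F ∧ IsClosed F

/-- `F` is a facet of the `d`-polytope `Q`. -/
def IsFacetOf (d : ℕ) (Q F : Set V) : Prop :=
  IsFaceOf Q F ∧ sdim F = (d : ℤ) - 1

/-- The segment `[a, b]` is an edge (a 1-dimensional face) of `Q`. -/
def IsEdgeOf (Q : Set V) (a b : V) : Prop :=
  IsFaceOf Q (segment ℝ a b) ∧ sdim (segment ℝ a b) = 1

/-- Clamped vertex indexing: `x_t = x_0` for `t ≤ 0` and `x_t = x_n` for `t ≥ n`. -/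
def xc {n : ℕ} (x : Fin (n + 1) → V) (t : ℤ) : V :=
  x ⟨(min (max t 0) n).toNat, by omega⟩

/-- The polytope spanned by the vertex array `x`. -/
def braxQ {n : ℕ} (x : Fin (n + 1) → V) : Set V :=
  convexHull ℝ (Set.range x)

/-- Vertex set of the simplex facet `T_i = [x_i, …, x_{i+d-1}]`. -/
def Tset (d : ℕ) {n : ℕ} (x : Fin (n + 1) → V) (i : ℤ) : Set V :=
  xc x '' Set.Icc i (i + (d : ℤ) - 1)

/-- Vertex set of the facet
`E_j = [x_0, x_{j-(d-2)}, …, x_{j-1}, x_{j+1}, …, x_{j+(d-2)}]`. -/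
def Eset (d : ℕ) {n : ℕ} (x : Fin (n + 1) → V) (j : ℤ) : Set V :=
  insert (x 0) (xc x '' (Set.Icc (j - ((d : ℤ) - 2)) (j + ((d : ℤ) - 2)) \ {j}))

/-- `x_0 < x_1 < ⋯ < x_n` is the vertex array of a `d`-braxtope: for `d ≤ 2` a
`d`-simplex; for `d ≥ 3` a `d`-polytope whose facets are exactly the `T_i`
(`0 ≤ i ≤ n - d + 1`) and the `E_j` (`2 ≤ j ≤ n`). -/
def IsBraxtope (d n : ℕ) (x : Fin (n + 1) → V) : Prop :=
  (d ≤ 2 → n = d ∧ AffineIndependent ℝ x) ∧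
  (3 ≤ d →
    d ≤ n ∧ Function.Injective x ∧
    sdim (braxQ x) = d ∧
    (∀ i, x i ∈ Set.extremePoints ℝ (braxQ x)) ∧
    (∀ F : Set V, IsFacetOf d (braxQ x) F ↔
      (∃ i : ℤ, 0 ≤ i ∧ i ≤ (n : ℤ) - d + 1 ∧ F = convexHull ℝ (Tset d x i)) ∨
      (∃ j : ℤ, 2 ≤ j ∧ j ≤ (n : ℤ) ∧ F = convexHull ℝ (Eset d x j))))


open Classical in
theorem brax_split {ι M : Type*} [AddCommMonoid M] (s : Finset ι) (w : ι → ℝ) (f : ι → M)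
    (hf : ∀ i, w i = 0 → f i = 0) :
    ∑ i ∈ s, f i = ∑ i ∈ s.filter (fun i => 0 < w i), f i
      + ∑ i ∈ s.filter (fun i => ¬ 0 < w i ∧ w i ≠ 0), f i := by
  rw [← Finset.sum_filter_add_sum_filter_not s (fun i => 0 < w i) f]
  congr 1
  rw [← Finset.filter_filter]
  symm
  apply Finset.sum_filter_of_ne
  intro i _ hi h0
  exact hi (hf i h0)

open Classical in
theorem brax_core {ι : Type*} {Q F : Set V} (hE : IsExtreme ℝ Q F) (hF : Convex ℝ F)
    (s : Finset ι) (w : ι → ℝ) (y : ι → V) (hw : ∑ i ∈ s, w i = 1)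
    (hy : ∀ i ∈ s, w i ≠ 0 → y i ∈ F) (hQ : ∑ i ∈ s, w i • y i ∈ Q) :
    ∑ i ∈ s, w i • y i ∈ F := by
  set A := s.filter (fun i => 0 < w i) with hA
  set B := s.filter (fun i => ¬ 0 < w i ∧ w i ≠ 0) with hB
  have k1 := brax_split s w w (fun i h => h)
  have k2 := brax_split s w (fun i => w i • y i) (fun i h => by simp [h])
  rw [← hA, ← hB] at k1 k2
  have hAF : ∀ i ∈ A, y i ∈ F := fun i hi => by
    simp only [hA, Finset.mem_filter] at hi
    exact hy i hi.1 hi.2.ne'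
  have hBF : ∀ i ∈ B, y i ∈ F := fun i hi => by
    simp only [hB, Finset.mem_filter] at hi
    exact hy i hi.1 hi.2.2
  have hB0 : ∀ i ∈ B, 0 < - w i := fun i hi => by
    simp only [hB, Finset.mem_filter] at hi
    have := lt_of_le_of_ne (not_lt.1 hi.2.1) hi.2.2
    linarith
  have hA0 : ∀ i ∈ A, 0 ≤ w i := fun i hi => by
    simp only [hA, Finset.mem_filter] at hi
    exact hi.2.le
  rcases B.eq_empty_or_nonempty with hBe | hBn
  · rw [hBe] at k1 k2
    simp only [Finset.sum_empty, add_zero] at k1 k2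
    rw [k2]
    exact hF.sum_mem hA0 (by rw [← k1, hw]) hAF
  · have hN : 0 < ∑ i ∈ B, - w i := Finset.sum_pos hB0 hBn
    set N := ∑ i ∈ B, - w i with hNdef
    have hP : ∑ i ∈ A, w i = 1 + N := by
      rw [hNdef, Finset.sum_neg_distrib]; linarith
    have ha : A.centerMass w y ∈ F := hF.centerMass_mem hA0 (by rw [hP]; linarith) hAF
    have hb : B.centerMass (fun i => - w i) y ∈ F :=
      hF.centerMass_mem (fun i hi => (hB0 i hi).le) hN hBF
    refine hE.left_mem_of_mem_openSegment hQ (hE.subset hb) ha ?_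
    refine ⟨1 / (1 + N), N / (1 + N), by positivity, by positivity, by field_simp, ?_⟩
    simp only [Finset.centerMass, hP, ← hNdef, k2, neg_smul, Finset.sum_neg_distrib]
    rw [smul_smul, smul_neg, smul_add]
    have : N / (1 + N) * N⁻¹ = (1 + N)⁻¹ := by field_simp
    rw [this, one_div]
    abel

theorem brax_aff {Q F : Set V} (hE : IsExtreme ℝ Q F) (hF : Convex ℝ F) {p : V}
    (hp : p ∈ affineSpan ℝ F) (hQ : p ∈ Q) : p ∈ F := by
  rw [← Subtype.range_coe (s := F)] at hp
  obtain ⟨s, w, hw, rfl⟩ := eq_affineCombination_of_mem_affineSpan hp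
  rw [Finset.affineCombination_eq_linear_combination _ _ _ hw] at hQ ⊢
  exact brax_core hE hF s w _ hw (fun i _ _ => i.2) hQ

theorem brax_hull {S F : Set V} (hE : IsExtreme ℝ (convexHull ℝ S) F) (_hF : Convex ℝ F) :
    F ⊆ convexHull ℝ (S ∩ F) := by
  intro z hz
  have hd := hE.convex_sdiff (convex_convexHull ℝ S)
  have hB : convexHull ℝ (S \ F) ⊆ convexHull ℝ S \ F :=
    convexHull_min (fun a ha => ⟨subset_convexHull ℝ S ha.1, ha.2⟩) hd
  have hzS := hE.subset hz
  rcases (S ∩ F).eq_empty_or_nonempty with h1 | h1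
  · rw [← Set.inter_union_sdiff S F, h1, Set.empty_union] at hzS
    exact absurd hz (hB hzS).2
  rcases (S \ F).eq_empty_or_nonempty with h2 | h2
  · rwa [← Set.inter_union_sdiff S F, h2, Set.union_empty] at hzS
  rw [← Set.inter_union_sdiff S F, convexHull_union h1 h2, mem_convexJoin] at hzS
  obtain ⟨a, ha, b, hb, hs⟩ := hzS
  rw [← insert_endpoints_openSegment] at hs
  rcases hs with rfl | rfl | hs
  · exact ha
  · exact absurd hz (hB hb).2
  · exact absurd (hE.right_mem_of_mem_openSegment
      (convexHull_mono Set.inter_subset_left ha) (hB hb).1 hz hs) (hB hb).2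

theorem brax_sdim_segment {a b : V} : sdim (segment ℝ a b) = 1 ↔ a ≠ b := by
  have hne : (segment ℝ a b).Nonempty := ⟨a, left_mem_segment ℝ a b⟩
  have h : (affineSpan ℝ (segment ℝ a b)).direction = Submodule.span ℝ {b - a} := by
    rw [← convexHull_pair, affineSpan_convexHull, direction_affineSpan,
      vectorSpan_pair_rev]
    rfl
  rw [sdim, if_pos hne, h]
  constructor
  · rintro h1 rfl
    rw [sub_self, Submodule.span_zero_singleton, finrank_bot] at h1
    simp at h1
  · intro hab
    rw [finrank_span_singleton (sub_ne_zero.2 hab.symm)]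
    rfl

theorem brax_facets (d n : ℕ) (hd : 3 ≤ d) (hn : d ≤ n)
    (x : Fin (n + 1) → V) (hx : IsBraxtope d n x) (j : ℕ) (hj : j ≤ d) (hj1 : j ≠ 1) :
    ∃ F : Set V, IsExtreme ℝ (braxQ x) F ∧ Convex ℝ F ∧ IsClosed F ∧ sdim F = (d : ℤ) - 1 ∧
      (∀ k : Fin (n + 1), (k : ℕ) ≤ d → (x k ∈ F ↔ (k : ℕ) ≠ j)) ∧
      (j = 0 ∨ j = d → ∀ k : Fin (n + 1), x k ∈ F → (k : ℕ) ≤ d) := by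
  obtain ⟨-, hinj, -, hext, hfac⟩ := hx.2 hd
  have hmem : ∀ (A : Set V) (k : Fin (n + 1)), A ⊆ Set.range x →
      (x k ∈ convexHull ℝ A ↔ x k ∈ A) := by
    intro A k hA
    refine ⟨fun h => ?_, fun h => subset_convexHull ℝ A h⟩
    exact extremePoints_convexHull_subset
      (inter_extremePoints_subset_extremePoints_of_subset (convexHull_mono hA) ⟨h, hext k⟩)
  have hxc : ∀ (t : ℤ) (k : Fin (n + 1)), xc x t = x k ↔ (min (max t 0) n).toNat = (k : ℕ) := by
    intro t k
    rw [xc, hinj.eq_iff, Fin.ext_iff]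
  have hTr : ∀ i, Tset d x i ⊆ Set.range x := by
    rintro i _ ⟨t, -, rfl⟩
    exact ⟨_, rfl⟩
  have hEr : ∀ i, Eset d x i ⊆ Set.range x := by
    rintro i _ (rfl | ⟨t, -, rfl⟩)
    · exact ⟨_, rfl⟩
    · exact ⟨_, rfl⟩
  have hT : ∀ (i : ℤ) (k : Fin (n + 1)), 0 ≤ i → i ≤ (n : ℤ) - d + 1 →
      (x k ∈ Tset d x i ↔ i ≤ (k : ℕ) ∧ ((k : ℕ) : ℤ) ≤ i + d - 1) := by
    intro i k h0 h1
    have hk := k.2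
    constructor
    · rintro ⟨t, ⟨ht1, ht2⟩, ht⟩
      rw [hxc] at ht
      omega
    · rintro ⟨h2, h3⟩
      refine ⟨(k : ℕ), ⟨h2, h3⟩, ?_⟩
      rw [hxc]
      omega
  have hEm : ∀ (k : Fin (n + 1)), 2 ≤ j → j < d → (k : ℕ) ≤ d →
      (x k ∈ Eset d x j ↔ (k : ℕ) ≠ j) := by
    intro k h0 h1 h2
    constructor
    · rintro (h | ⟨t, ⟨⟨ht1, ht2⟩, ht3⟩, ht⟩)
      · have := hinj h
        subst this
        simp
        omega
      · rw [hxc] at ht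
        simp only [Set.mem_singleton_iff] at ht3
        omega
    · intro h3
      by_cases hk0 : k = 0
      · left; rw [hk0]
      · have hk0' : (k : ℕ) ≠ 0 := fun h => hk0 (Fin.ext (by simpa using h))
        right
        refine ⟨(k : ℕ), ⟨⟨by omega, by omega⟩, ?_⟩, ?_⟩
        · simp only [Set.mem_singleton_iff]
          omega
        · rw [hxc]
          omega
  by_cases h0 : j = 0
  · obtain ⟨⟨a, b, c⟩, e⟩ := (hfac _).2 (Or.inl ⟨1, by omega, by omega, rfl⟩)
    refine ⟨_, a, b, c, e, ?_, ?_⟩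
    · intro k hk
      rw [hmem _ _ (hTr _), hT _ _ (by omega) (by omega)]
      omega
    · intro _ k
      rw [hmem _ _ (hTr _), hT _ _ (by omega) (by omega)]
      omega
  by_cases h1 : j = d
  · obtain ⟨⟨a, b, c⟩, e⟩ := (hfac _).2 (Or.inl ⟨0, by omega, by omega, rfl⟩)
    refine ⟨_, a, b, c, e, ?_, ?_⟩
    · intro k hk
      rw [hmem _ _ (hTr _), hT _ _ (by omega) (by omega)]
      omega
    · intro _ k
      rw [hmem _ _ (hTr _), hT _ _ (by omega) (by omega)]
      omega
  · obtain ⟨⟨a, b, c⟩, e⟩ := (hfac _).2 (Or.inr ⟨j, by omega, by omega, rfl⟩)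
    refine ⟨_, a, b, c, e, ?_, ?_⟩
    · intro k hk
      rw [hmem _ _ (hEr _), hEm _ (by omega) (by omega) hk]
    · intro h
      omega

/-- In a `d`-braxtope, `[x_1, x_u]` is an edge iff `u = 0` or `2 ≤ u ≤ d`. -/
theorem braxtope_edges_on_x1 (d n : ℕ) (hd : 3 ≤ d) (hn : d ≤ n)
    (x : Fin (n + 1) → V) (hx : IsBraxtope d n x) (u : Fin (n + 1)) :
    IsEdgeOf (braxQ x) (x 1) (x u) ↔ (u : ℕ) = 0 ∨ (2 ≤ (u : ℕ) ∧ (u : ℕ) ≤ d) := by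
  obtain ⟨-, hinj, hdim, hext, -⟩ := hx.2 hd
  have hF := brax_facets d n hd hn x hx
  have hone : ((1 : Fin (n + 1)) : ℕ) = 1 := by
    rw [Fin.val_one']
    exact Nat.mod_eq_of_lt (by omega)
  have hQx : ∀ k, x k ∈ braxQ x := fun k => subset_convexHull ℝ _ ⟨k, rfl⟩
  have hQc : Convex ℝ (braxQ x) := convex_convexHull ℝ _
  constructor
  · rintro ⟨⟨hEx, -, -⟩, hs⟩
    rw [brax_sdim_segment] at hs
    have hu1 : (u : ℕ) ≠ 1 := fun h => hs (by rw [Fin.ext (hone.trans h.symm)])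
    by_contra hcon
    have hud : d < (u : ℕ) := by omega
    let y : Fin (d + 1) → V := fun k => x ⟨k, by omega⟩
    have hyQ : ∀ k, y k ∈ braxQ x := fun k => hQx _
    -- the affine span of the first d+1 vertices is everything
    have hspan : affineSpan ℝ (Set.range y) = affineSpan ℝ (braxQ x) := by
      obtain ⟨F, hFe, hFc, -, hFd, hF1, hF2⟩ := hF d le_rfl (by omega)
      have hFne : F.Nonempty := by
        by_contra h
        rw [sdim, if_neg h] at hFd
        omega
      have hQne : (braxQ x).Nonempty := ⟨_, hQx 0⟩
      rw [sdim, if_pos hFne] at hFd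
      rw [sdim, if_pos hQne] at hdim
      have hFy : affineSpan ℝ F ≤ affineSpan ℝ (Set.range y) := by
        refine (affineSpan_mono ℝ (brax_hull hFe hFc)).trans ?_
        rw [affineSpan_convexHull]
        apply affineSpan_mono
        rintro _ ⟨⟨k, rfl⟩, hk⟩
        exact ⟨⟨k, by have := hF2 (Or.inr rfl) k hk; omega⟩, rfl⟩
      have hyQ' : affineSpan ℝ (Set.range y) ≤ affineSpan ℝ (braxQ x) := by
        apply affineSpan_mono
        rintro _ ⟨k, rfl⟩
        exact hyQ k
      have hfd : FiniteDimensional ℝ (affineSpan ℝ (braxQ x)).direction :=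
        FiniteDimensional.of_finrank_pos (by omega)
      have hfd2 : FiniteDimensional ℝ (affineSpan ℝ (Set.range y)).direction :=
        Submodule.finiteDimensional_of_le (AffineSubspace.direction_le hyQ')
      have hFne' : ((affineSpan ℝ F : AffineSubspace ℝ V) : Set V).Nonempty :=
        (affineSpan_nonempty ℝ).2 hFne
      have hlt : affineSpan ℝ F < affineSpan ℝ (Set.range y) := by
        refine lt_of_le_of_ne hFy ?_
        intro h
        have h1 : y (Fin.last d) ∈ affineSpan ℝ F := by
          rw [h]; exact subset_affineSpan ℝ _ ⟨_, rfl⟩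
        have h2 := brax_aff hFe hFc h1 (hyQ _)
        exact (hF1 _ (by simp)).1 h2 (by simp)
      have hlt2 := AffineSubspace.direction_lt_of_nonempty hlt hFne'
      have hlt3 := Submodule.finrank_lt_finrank_of_lt hlt2
      have heq := Submodule.eq_of_le_of_finrank_le (AffineSubspace.direction_le hyQ')
        (by omega)
      exact AffineSubspace.eq_of_direction_eq_of_nonempty_of_le heq
        ((affineSpan_nonempty ℝ).2 ⟨_, ⟨0, rfl⟩⟩) hyQ'
    have hxu : x u ∈ affineSpan ℝ (Set.range y) := by
      rw [hspan]; exact subset_affineSpan ℝ _ (hQx u)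
    obtain ⟨c, hc, hxc⟩ := eq_affineCombination_of_mem_affineSpan_of_fintype hxu
    rw [Finset.affineCombination_eq_linear_combination _ _ _ hc] at hxc
    -- signs
    have hsign : ∀ j : Fin (d + 1), (j : ℕ) ≠ 1 → 0 ≤ c j := by
      intro j hj
      by_contra hneg
      push Not at hneg
      obtain ⟨F, hFe, hFc, -, -, hF1, -⟩ := hF j (by omega) hj
      have hyj : y j ∉ F := fun h => (hF1 _ (by simp; omega)).1 h rfl
      have hpos : 0 < 1 - c j := by linarith
      have hsum : ∑ k ∈ Finset.univ.erase j, c k = 1 - c j := by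
        rw [← hc, ← Finset.add_sum_erase _ _ (Finset.mem_univ j)]; ring
      have hsum2 : ∑ k ∈ Finset.univ.erase j, c k • y k = x u - c j • y j := by
        rw [hxc, ← Finset.add_sum_erase _ _ (Finset.mem_univ j)]; abel
      have hp : ∑ k ∈ Finset.univ.erase j, ((1 - c j)⁻¹ * c k) • y k
          = (1 - c j)⁻¹ • x u + ((1 - c j)⁻¹ * (- c j)) • y j := by
        simp only [mul_smul]
        rw [← Finset.smul_sum, hsum2, smul_sub, neg_smul, smul_neg, sub_eq_add_neg]
      have hw1 : (1 - c j)⁻¹ + (1 - c j)⁻¹ * (- c j) = 1 := by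
        field_simp; ring
      have ha : 0 < (1 - c j)⁻¹ := by positivity
      have hb : 0 < (1 - c j)⁻¹ * (- c j) := mul_pos ha (by linarith)
      have hpF := brax_core hFe hFc (Finset.univ.erase j) (fun k => (1 - c j)⁻¹ * c k) y
        (by rw [← Finset.mul_sum, hsum]; field_simp)
        (fun k hk _ => (hF1 _ (by simp; omega)).2 (by
          intro h
          exact (Finset.mem_erase.1 hk).1 (Fin.ext h)))
        (by rw [hp]; exact hQc (hQx u) (hyQ j) ha.le hb.le hw1)
      exact hyj (hFe.right_mem_of_mem_openSegment (hQx u) (hyQ j) hpF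
        ⟨_, _, ha, hb, hw1, hp.symm⟩)
    let e : Fin (d + 1) := ⟨1, by omega⟩
    have hye : y e = x 1 := by
      show x _ = x 1
      congr 1
      exact Fin.ext hone.symm
    have hne : ∀ k ∈ Finset.univ.erase e, (k : ℕ) ≠ 1 := fun k hk h =>
      (Finset.mem_erase.1 hk).1 (Fin.ext h)
    have hsum : ∑ k ∈ Finset.univ.erase e, c k = 1 - c e := by
      rw [← hc, ← Finset.add_sum_erase _ _ (Finset.mem_univ e)]; ring
    have hsum2 : ∑ k ∈ Finset.univ.erase e, c k • y k = x u - c e • x 1 := by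
      rw [hxc, ← Finset.add_sum_erase _ _ (Finset.mem_univ e), hye]; abel
    have hnn : ∀ k ∈ Finset.univ.erase e, 0 ≤ c k := fun k hk => hsign k (hne k hk)
    have hC : 0 < 1 - c e := by
      rw [← hsum]
      refine lt_of_le_of_ne (Finset.sum_nonneg hnn) ?_
      intro h0
      have hz := (Finset.sum_eq_zero_iff_of_nonneg hnn).1 h0.symm
      have h1 : ∑ k ∈ Finset.univ.erase e, c k • y k = 0 :=
        Finset.sum_eq_zero (fun k hk => by rw [hz k hk, zero_smul])
      have h2 : c e = 1 := by linarith
      rw [hsum2, h2, one_smul, sub_eq_zero] at h1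
      exact hs h1.symm
    have hdiff : Convex ℝ (braxQ x \ segment ℝ (x 1) (x u)) := hEx.convex_sdiff hQc
    have hz : (Finset.univ.erase e).centerMass c y ∈ braxQ x \ segment ℝ (x 1) (x u) := by
      refine hdiff.centerMass_mem hnn (by rw [hsum]; exact hC) ?_
      intro k hk
      refine ⟨hyQ k, fun hseg => ?_⟩
      have h1 := (mem_extremePoints_iff_forall_segment.1 (hext ⟨k, by omega⟩)).2 _ (hQx 1) _ (hQx u) hseg
      rcases h1 with h1 | h1
      · have := Fin.ext_iff.1 (hinj h1)
        rw [hone] at this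
        exact hne k hk this.symm
      · have := Fin.ext_iff.1 (hinj h1)
        simp only at this
        omega
    set C := 1 - c e with hCdef
    have hce : c e = 1 - C := by rw [hCdef]; ring
    apply hz.2
    refine hEx.right_mem_of_mem_openSegment (hQx 1) hz.1
      (z := (C / (1 + C)) • x 1 + (1 / (1 + C)) • x u) ?_ ?_
    · refine ⟨C / (1 + C), 1 / (1 + C), by positivity, by positivity, by field_simp; ring, rfl⟩
    · refine ⟨1 / (1 + C), C / (1 + C), by positivity, by positivity, by field_simp, ?_⟩
      rw [Finset.centerMass, hsum, hsum2, hce, smul_smul]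
      have : C / (1 + C) * C⁻¹ = 1 / (1 + C) := by field_simp
      rw [this]
      match_scalars <;> field_simp <;> ring
  · intro hu
    have hu1 : (u : ℕ) ≠ 1 := by omega
    have hud : (u : ℕ) ≤ d := by omega
    choose! F hFe hFc hFcl _ hF1 hF2 using hF
    let J : Set ℕ := {j | j ≤ d ∧ j ≠ 1 ∧ j ≠ u}
    have hJ : J.Nonempty := by
      by_cases h : (u : ℕ) = 0
      · exact ⟨d, le_rfl, by omega, by omega⟩
      · exact ⟨0, by omega, by omega, by omega⟩
    let G : Set V := ⋂ j ∈ J, F j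
    have hGe : IsExtreme ℝ (braxQ x) G :=
      ⟨fun p hp => by
          obtain ⟨j, hj⟩ := hJ
          exact (hFe j hj.1 hj.2.1).subset (Set.mem_iInter₂.1 hp j hj),
        fun a ha b hb p hp hs => Set.mem_iInter₂.2 fun j hj =>
          (hFe j hj.1 hj.2.1).left_mem_of_mem_openSegment ha hb
            (Set.mem_iInter₂.1 hp j hj) hs⟩
    have hGc : Convex ℝ G := convex_iInter₂ (fun j hj => hFc j hj.1 hj.2.1)
    have hx1 : x 1 ∈ G := Set.mem_iInter₂.2 fun j hj =>
      (hF1 j hj.1 hj.2.1 _ (by omega)).2 (by rw [hone]; exact hj.2.1.symm)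
    have hxu : x u ∈ G := Set.mem_iInter₂.2 fun j hj =>
      (hF1 j hj.1 hj.2.1 _ hud).2 hj.2.2.symm
    have hG : G = segment ℝ (x 1) (x u) := by
      apply Set.Subset.antisymm
      · refine (brax_hull hGe hGc).trans ?_
        rw [← convexHull_pair]
        apply convexHull_mono
        rintro _ ⟨⟨k, rfl⟩, hk⟩
        have hk' := Set.mem_iInter₂.1 hk
        have hkd : (k : ℕ) ≤ d := by
          by_cases h : (u : ℕ) = 0
          · exact hF2 d le_rfl (by omega) (Or.inr rfl) k
              (hk' d ⟨le_rfl, by omega, by omega⟩)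
          · exact hF2 0 (by omega) (by omega) (Or.inl rfl) k
              (hk' 0 ⟨by omega, by omega, by omega⟩)
        by_cases h1 : (k : ℕ) = 1
        · left
          rw [Fin.ext (h1.trans hone.symm)]
        by_cases h2 : (k : ℕ) = u
        · right
          rw [Fin.ext h2]
          rfl
        · exact absurd rfl ((hF1 k hkd h1 k hkd).1 (hk' k ⟨hkd, h1, h2⟩))
      · exact hGc.segment_subset hx1 hxu
    refine ⟨⟨hG ▸ hGe, convex_segment _ _, ?_⟩, ?_⟩
    · rw [← hG]
      exact isClosed_biInter (fun j hj => hFcl j hj.1 hj.2.1)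
    · rw [brax_sdim_segment]
      intro h
      have := Fin.ext_iff.1 (hinj h)
      omega
end
end

section
/- In a d-braxtope Q^{d,n} with vertex array x_0 < x_1 < ... < x_n (n ≥ d ≥ 3), for 2 ≤ t ≤ n-1, the segment [x_t, x_u] is an edge of Q if and only if u = 0, or t-d+1 ≤ u ≤ t+d-1 with u ≠ t. -/
open Set

noncomputable section

variable {V : Type*} [NormedAddCommGroup V] [NormedSpace ℝ V]

theorem sep_sub (p : Submodule ℝ V) (h : IsClosed (p : Set V)) (v : V) (hv : v ∉ p) :
    ∃ f : StrongDual ℝ V, (∀ x ∈ p, f x = 0) ∧ f v ≠ 0 := by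
  obtain ⟨f, u, h1, h2⟩ := geometric_hahn_banach_closed_point p.convex h hv
  have hz : ∀ x ∈ p, f x = 0 := by
    intro a ha
    by_contra hne
    have := h1 ((u / f a) • a) (p.smul_mem _ ha)
    rw [map_smul, smul_eq_mul, div_mul_cancel₀ _ hne] at this
    exact lt_irrefl _ this
  refine ⟨f, hz, ?_⟩
  have := h1 0 p.zero_mem
  rw [map_zero] at this
  exact (this.trans h2).ne'

theorem small_eps {ι : Type*} [Finite ι] (y z : ι → ℝ) (hy : ∀ i, 0 ≤ y i)
    (hz : ∀ i, y i = 0 → z i = 0) : ∃ e : ℝ, 0 < e ∧ ∀ i, |e * z i| ≤ y i := by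
  have : ∀ᶠ e : ℝ in nhdsWithin 0 (Set.Ioi 0), ∀ i, |e * z i| ≤ y i := by
    rw [Filter.eventually_all]
    intro i
    rcases (hy i).eq_or_lt with h | h
    · refine Filter.Eventually.of_forall fun e => ?_
      simp [hz i h.symm, ← h]
    · have ht : Filter.Tendsto (fun e : ℝ => |e * z i|) (nhds 0) (nhds |0 * z i|) :=
        (Continuous.tendsto (by fun_prop) 0)
      rw [zero_mul, abs_zero] at ht
      exact ((ht.eventually_lt_const h).filter_mono nhdsWithin_le_nhds).mono fun e he => he.le
  obtain ⟨e, h1, h2⟩ := (this.and self_mem_nhdsWithin).exists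
  exact ⟨e, h2, h1⟩

/-- The values at the vertices of an affine functional vanishing at `x t`. -/
def valMap {n : ℕ} (x : Fin (n + 1) → V) (t : Fin (n + 1)) :
    StrongDual ℝ V →ₗ[ℝ] (Fin (n + 1) → ℝ) where
  toFun f i := f (x i - x t)
  map_add' f g := by ext i; simp
  map_smul' c f := by ext i; simp [mul_sub]

theorem extremal_functional {n : ℕ} (x : Fin (n + 1) → V) (t u v : Fin (n + 1))
    (f0 : StrongDual ℝ V) (h0 : ∀ i, 0 ≤ f0 (x i - x t)) (hu : f0 (x u - x t) = 0)
    (hv : 0 < f0 (x v - x t)) :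
    ∃ f : StrongDual ℝ V, (∀ i, 0 ≤ f (x i - x t)) ∧ f (x u - x t) = 0 ∧
      0 < f (x v - x t) ∧
      ∀ g : StrongDual ℝ V, (∀ i, f (x i - x t) = 0 → g (x i - x t) = 0) →
        ∃ c : ℝ, ∀ i, g (x i - x t) = c * f (x i - x t) := by
  set K : Set (Fin (n + 1) → ℝ) :=
    stdSimplex ℝ (Fin (n + 1)) ∩ ((LinearMap.range (valMap x t) : Set _) ∩ {y | y u = 0}) with hK
  have hKc : IsCompact K := by
    refine (isCompact_stdSimplex ℝ _).inter_right (IsClosed.inter ?_ ?_)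
    · exact Submodule.closed_of_finiteDimensional _
    · exact isClosed_eq (continuous_apply u) continuous_const
  have hKv : Convex ℝ K := by
    refine (convex_stdSimplex ℝ _).inter ((Submodule.convex _).inter ?_)
    intro a ha b hb p q _ _ _
    simp only [Set.mem_ofPred_eq] at ha hb ⊢
    simp [ha, hb]
  have hex : ∃ y ∈ K.extremePoints ℝ, y v ≠ 0 := by
    by_contra! hcon
    have hsub : K ⊆ {y | y v = 0} := by
      rw [← closure_convexHull_extremePoints hKc hKv]
      refine closure_minimal (convexHull_min hcon ?_) ?_
      · intro a ha b hb p q _ _ _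
        simp only [Set.mem_ofPred_eq] at ha hb ⊢
        simp [ha, hb]
      · exact isClosed_eq (continuous_apply v) continuous_const
    have hS : 0 < ∑ i, f0 (x i - x t) :=
      Finset.sum_pos' (fun i _ => h0 i) ⟨v, Finset.mem_univ _, hv⟩
    set S := ∑ i, f0 (x i - x t)
    have hmem : valMap x t (S⁻¹ • f0) ∈ K := by
      refine ⟨⟨fun i => ?_, ?_⟩, ⟨_, rfl⟩, ?_⟩
      · exact mul_nonneg (inv_nonneg.2 hS.le) (h0 i)
      · change ∑ i, S⁻¹ * f0 (x i - x t) = 1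
        rw [← Finset.mul_sum]
        exact inv_mul_cancel₀ hS.ne'
      · change S⁻¹ * f0 (x u - x t) = 0
        rw [hu, mul_zero]
    have h3 : S⁻¹ * f0 (x v - x t) = 0 := hsub hmem
    exact (mul_pos (inv_pos.2 hS) hv).ne' h3
  obtain ⟨y, hy, hyv⟩ := hex
  obtain ⟨hyK, hyE⟩ := mem_extremePoints.1 hy
  obtain ⟨⟨hy0, hy1⟩, ⟨f, hf⟩, hyu⟩ := hyK
  have hfi : ∀ i, f (x i - x t) = y i := fun i => congrFun hf i
  refine ⟨f, fun i => (hfi i).symm ▸ hy0 i, (hfi u).trans hyu, ?_, ?_⟩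
  · rw [hfi]; exact lt_of_le_of_ne (hy0 v) (Ne.symm hyv)
  intro g hg
  set c := ∑ i, g (x i - x t) with hc
  refine ⟨c, ?_⟩
  set z := valMap x t (g - c • f) with hz
  have hzi : ∀ i, z i = g (x i - x t) - c * y i := by
    intro i
    rw [← hfi]
    rfl
  have hzs : ∑ i, z i = 0 := by
    simp only [hzi, Finset.sum_sub_distrib, ← Finset.mul_sum, hy1]
    simp [hc]
  have hz0 : ∀ i, y i = 0 → z i = 0 := by
    intro i hi
    rw [hzi, hg i (by rw [hfi, hi]), hi]; simp
  obtain ⟨e, he, hle⟩ := small_eps y z hy0 hz0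
  have hmem : ∀ s : ℝ, |s| = 1 → y + (s * e) • z ∈ K := by
    intro s hs
    refine ⟨⟨fun i => ?_, ?_⟩, ⟨f + (s * e) • (g - c • f), ?_⟩, ?_⟩
    · have h1 : |s * (e * z i)| ≤ y i := by rw [abs_mul, hs, one_mul]; exact hle i
      have := (abs_le.1 h1).1
      simp only [Pi.add_apply, Pi.smul_apply, smul_eq_mul]
      rw [mul_assoc]
      linarith
    · simp only [Pi.add_apply, Pi.smul_apply, smul_eq_mul, Finset.sum_add_distrib,
        ← Finset.mul_sum, hzs, hy1]
      simp
    · rw [map_add, map_smul, hf]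
    · have hyu' : y u = 0 := hyu
      simp [hyu', hz0 u hyu']
  have h1 := hyE _ (hmem 1 (by simp)) _ (hmem (-1) (by simp))
    ⟨1 / 2, 1 / 2, by norm_num, by norm_num, by norm_num, by module⟩
  intro i
  have h2 := congrFun h1.1 i
  simp only [Pi.add_apply, Pi.smul_apply, smul_eq_mul, one_mul] at h2
  have h3 : z i = 0 := by
    have : e * z i = 0 := by linarith
    exact (mul_eq_zero.1 this).resolve_left he.ne'
  rw [hzi] at h3
  rw [hfi]; linarith

theorem facet_exists {n : ℕ} (d : ℕ) (x : Fin (n + 1) → V) (hdim : sdim (braxQ x) = d)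
    (t u v : Fin (n + 1))
    (f0 : StrongDual ℝ V) (h0 : ∀ i, 0 ≤ f0 (x i - x t)) (hu : f0 (x u - x t) = 0)
    (hv : 0 < f0 (x v - x t)) :
    ∃ F, IsFacetOf d (braxQ x) F ∧ x t ∈ F ∧ x u ∈ F ∧ x v ∉ F := by
  obtain ⟨f, hf0, hfu, hfv, hf⟩ := extremal_functional x t u v f0 h0 hu hv
  have hQ : ∀ i, x i ∈ braxQ x := fun i => subset_convexHull ℝ _ ⟨i, rfl⟩
  have hQge : ∀ q ∈ braxQ x, f (x t) ≤ f q := by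
    have : braxQ x ⊆ {q | f (x t) ≤ f q} := by
      refine convexHull_min ?_ (convex_halfSpace_ge f.isLinear _)
      rintro _ ⟨i, rfl⟩
      have := hf0 i
      rw [map_sub] at this
      simpa using this
    exact this
  set F : Set V := braxQ x ∩ {q | f q = f (x t)} with hF
  have hxt : x t ∈ F := ⟨hQ t, rfl⟩
  have hzero : ∀ i, f (x i - x t) = 0 → x i ∈ F := fun i hi =>
    ⟨hQ i, by rw [map_sub, sub_eq_zero] at hi; exact hi⟩
  have hspan : vectorSpan ℝ (braxQ x) = Submodule.span ℝ (Set.range fun i => x i - x t) := by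
    rw [← direction_affineSpan, braxQ, affineSpan_convexHull, direction_affineSpan,
      vectorSpan_range_eq_span_range_vsub_right ℝ x t]
    rfl
  have hfin : FiniteDimensional ℝ (vectorSpan ℝ (braxQ x)) := by
    rw [hspan]; exact FiniteDimensional.span_of_finite ℝ (Set.finite_range _)
  have hle : vectorSpan ℝ F ≤ vectorSpan ℝ (braxQ x) := vectorSpan_mono ℝ inter_subset_left
  have hfinF : FiniteDimensional ℝ (vectorSpan ℝ F) := Submodule.finiteDimensional_of_le hle
  have hfF : ∀ w ∈ vectorSpan ℝ F, f w = 0 := by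
    have : vectorSpan ℝ F ≤ LinearMap.ker f.toLinearMap := by
      rw [vectorSpan_def, Submodule.span_le]
      rintro _ ⟨a, ha, b, hb, rfl⟩
      have h1 : f a = f (x t) := ha.2
      have h2 : f b = f (x t) := hb.2
      simp [h1, h2]
    exact fun w hw => this hw
  have hwv : x v - x t ∉ vectorSpan ℝ F := fun h => hfv.ne' (hfF _ h)
  have hsup : vectorSpan ℝ F ⊔ Submodule.span ℝ {x v - x t} = vectorSpan ℝ (braxQ x) := by
    apply le_antisymm
    · refine sup_le hle ?_
      rw [Submodule.span_singleton_le_iff_mem]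
      exact vsub_mem_vectorSpan ℝ (hQ v) (hQ t)
    · rw [hspan, Submodule.span_le]
      rintro _ ⟨i, rfl⟩
      by_contra hi
      obtain ⟨g, hg1, hg2⟩ := sep_sub (vectorSpan ℝ F ⊔ Submodule.span ℝ {x v - x t})
        (Submodule.closed_of_finiteDimensional _) _ hi
      obtain ⟨c, hc⟩ := hf g (fun j hj => hg1 _ (Submodule.mem_sup_left
        (vsub_mem_vectorSpan ℝ (hzero j hj) hxt)))
      have h1 := hg1 _ (Submodule.mem_sup_right (Submodule.mem_span_singleton_self (x v - x t)))
      rw [hc] at h1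
      have hc0 := (mul_eq_zero.1 h1).resolve_right hfv.ne'
      apply hg2
      rw [hc, hc0, zero_mul]
  have hrank : Module.finrank ℝ (vectorSpan ℝ (braxQ x)) =
      Module.finrank ℝ (vectorSpan ℝ F) + 1 := by
    have h1 := Submodule.finrank_sup_add_finrank_inf_eq (vectorSpan ℝ F)
      (Submodule.span ℝ {x v - x t})
    have h2 : vectorSpan ℝ F ⊓ Submodule.span ℝ {x v - x t} = ⊥ := by
      rw [← disjoint_iff]
      exact (Submodule.disjoint_span_singleton_of_notMem hwv)
    rw [h2, hsup, finrank_bot, finrank_span_singleton] at h1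
    · exact h1
    · intro h
      rw [h] at hfv
      simp at hfv
  refine ⟨F, ⟨⟨?_, ?_, ?_⟩, ?_⟩, hxt, hzero u hfu, ?_⟩
  · refine ⟨inter_subset_left, ?_⟩
    rintro a ha b hb z hz ⟨p, q, hp, hq, hpq, rfl⟩
    refine ⟨ha, ?_⟩
    have h1 : f (p • a + q • b) = f (x t) := hz.2
    rw [map_add, map_smul, map_smul, smul_eq_mul, smul_eq_mul] at h1
    have h2 := hQge a ha
    have h3 := hQge b hb
    change f a = f (x t)
    have hq' : q = 1 - p := by linarith
    subst hq'
    nlinarith [mul_le_mul_of_nonneg_left h3 hq.le]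
  · refine (convex_convexHull ℝ _).inter ?_
    exact convex_hyperplane f.isLinear _
  · exact ((Set.finite_range x).isCompact_convexHull ℝ).isClosed.inter
      (isClosed_eq f.continuous continuous_const)
  · rw [sdim, if_pos ⟨_, hQ t⟩, direction_affineSpan, hrank] at hdim
    rw [sdim, if_pos ⟨_, hxt⟩, direction_affineSpan]
    push_cast at hdim
    linarith
  · intro h
    have : f (x v) = f (x t) := h.2
    rw [map_sub, this, sub_self] at hfv
    exact lt_irrefl _ hfv

theorem edge_functional {n : ℕ} (x : Fin (n + 1) → V) (t u v : Fin (n + 1))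
    (hE : IsExtreme ℝ (braxQ x) (segment ℝ (x t) (x u)))
    (hv : x v ∉ segment ℝ (x t) (x u)) :
    ∃ f0 : StrongDual ℝ V, (∀ i, 0 ≤ f0 (x i - x t)) ∧ f0 (x u - x t) = 0 ∧
      0 < f0 (x v - x t) := by
  have hQ : ∀ i, x i ∈ braxQ x := fun i => subset_convexHull ℝ _ ⟨i, rfl⟩
  set A : Set V := convexHull ℝ (x '' {i | x i ∉ segment ℝ (x t) (x u)}) with hA
  have hAQ : A ⊆ braxQ x \ segment ℝ (x t) (x u) := by
    refine convexHull_min ?_ (hE.convex_sdiff (convex_convexHull ℝ _))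
    rintro _ ⟨i, hi, rfl⟩
    exact ⟨hQ i, hi⟩
  have hAc : IsCompact A := ((Set.toFinite _).image x).isCompact_convexHull ℝ
  have hfd : FiniteDimensional ℝ (affineSpan ℝ {x t, x u}).direction := by
    rw [direction_affineSpan]
    exact finiteDimensional_vectorSpan_of_finite ℝ (Set.toFinite _)
  have hdisj : Disjoint A (affineSpan ℝ {x t, x u} : Set V) := by
    rw [Set.disjoint_left]
    intro p hp hpL
    obtain ⟨hpQ, hps⟩ := hAQ hp
    obtain ⟨r, rfl⟩ := mem_affineSpan_pair_iff_exists_lineMap_eq.1 hpL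
    rw [AffineMap.lineMap_apply_module] at hpQ hps
    rcases lt_or_ge r 0 with h | h
    · have h1 : 0 < 1 - r := by linarith
      refine hps (hE.left_mem_of_mem_openSegment hpQ (hQ u) (left_mem_segment ℝ _ _) ?_)
      refine ⟨1 / (1 - r), (-r) / (1 - r), by positivity, div_pos (by linarith) h1, ?_, ?_⟩
      · field_simp
        try ring
      · match_scalars <;> field_simp <;> ring
    rcases le_or_gt r 1 with h' | h'
    · exact hps ⟨1 - r, r, by linarith, h, by ring, rfl⟩
    · have h1 : 0 < r := by linarith
      refine hps (hE.left_mem_of_mem_openSegment hpQ (hQ t) (right_mem_segment ℝ _ _) ?_)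
      refine ⟨1 / r, (r - 1) / r, by positivity, div_pos (by linarith) h1, ?_, ?_⟩
      · field_simp
        try ring
      · match_scalars <;> field_simp <;> ring
  obtain ⟨f, a, b, hfa, hab, hfb⟩ := geometric_hahn_banach_compact_closed
    (convex_convexHull ℝ _) hAc (AffineSubspace.convex _)
    (AffineSubspace.closed_of_finiteDimensional (affineSpan ℝ {x t, x u})) hdisj
  have hline : ∀ r : ℝ, b < f (x t) + r * f (x u - x t) := by
    intro r
    have := hfb _ (AffineMap.lineMap_mem_affineSpan_pair r (x t) (x u))
    rw [AffineMap.lineMap_apply] at this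
    simp only [vsub_eq_sub, vadd_eq_add, map_add, map_smul, smul_eq_mul] at this
    linarith
  have hzero : f (x u - x t) = 0 := by
    by_contra hne
    have := hline ((b - f (x t)) / f (x u - x t))
    rw [div_mul_cancel₀ _ hne] at this
    linarith
  have ht : b < f (x t) := by simpa using hline 0
  have hout : ∀ i, x i ∉ segment ℝ (x t) (x u) → f (x i) < f (x t) := fun i hi =>
    ((hfa _ (subset_convexHull ℝ _ ⟨i, hi, rfl⟩)).trans hab).trans ht
  have hin : ∀ p ∈ segment ℝ (x t) (x u), f p = f (x t) := by
    rintro _ ⟨p, q, _, _, hpq, rfl⟩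
    rw [map_sub, sub_eq_zero] at hzero
    rw [map_add, map_smul, map_smul, hzero, smul_eq_mul, smul_eq_mul, ← add_mul, hpq, one_mul]
  refine ⟨-f, fun i => ?_, by simp [hzero], ?_⟩
  · by_cases hi : x i ∈ segment ℝ (x t) (x u)
    · have := hin _ hi
      simp [this]
    · have := hout i hi
      simp [this.le]
  · have := hout v hv
    simpa using this

theorem mem_Tset {d n : ℕ} {x : Fin (n + 1) → V} (hinj : Function.Injective x) {i : ℤ}
    (h0 : 0 ≤ i) (h1 : i ≤ (n : ℤ) - d + 1) (v : Fin (n + 1)) :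
    x v ∈ Tset d x i ↔ i ≤ (v : ℕ) ∧ ((v : ℕ) : ℤ) ≤ i + d - 1 := by
  have hv := v.2
  constructor
  · rintro ⟨k, ⟨hk1, hk2⟩, hk⟩
    have := congrArg Fin.val (hinj hk)
    simp only at this
    omega
  · rintro ⟨h2, h3⟩
    refine ⟨(v : ℕ), ⟨h2, h3⟩, ?_⟩
    unfold xc
    congr 1
    ext
    simp only
    omega

theorem mem_Eset {d n : ℕ} (hd : 3 ≤ d) {x : Fin (n + 1) → V} (hinj : Function.Injective x) {j : ℤ}
    (h0 : 2 ≤ j) (h1 : j ≤ (n : ℤ)) (v : Fin (n + 1)) :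
    x v ∈ Eset d x j ↔ (v : ℕ) = 0 ∨ (j - (d - 2) ≤ (v : ℕ) ∧ ((v : ℕ) : ℤ) ≤ j + (d - 2) ∧
      (((v : ℕ) : ℤ) ≠ j ∨ j = n)) := by
  have hv := v.2
  constructor
  · rintro (h | ⟨k, ⟨⟨hk1, hk2⟩, hk3⟩, hk⟩)
    · left
      rw [hinj h]; rfl
    · have := congrArg Fin.val (hinj hk)
      simp only [Set.mem_singleton_iff] at this hk3
      omega
  · rintro (h | ⟨h2, h3, h4⟩)
    · left
      congr 1
      ext
      simpa using h
    · right
      by_cases hj : ((v : ℕ) : ℤ) = j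
      · refine ⟨(v : ℕ) + 1, ⟨⟨by omega, by omega⟩, ?_⟩, ?_⟩
        · simp only [Set.mem_singleton_iff]; omega
        · unfold xc
          congr 1
          ext
          simp only
          omega
      · refine ⟨(v : ℕ), ⟨⟨by omega, by omega⟩, hj⟩, ?_⟩
        unfold xc
        congr 1
        ext
        simp only
        omega

/-- A vertex of `Q` in the hull of a set of points of `Q` lies in the set. -/
theorem vertex_mem {Q S : Set V} (hS : convexHull ℝ S ⊆ Q) {p : V}
    (hp : p ∈ Q.extremePoints ℝ) (h : p ∈ convexHull ℝ S) : p ∈ S :=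
  extremePoints_convexHull_subset (inter_extremePoints_subset_extremePoints_of_subset hS ⟨h, hp⟩)

/-- The combinatorial core: the other vertices are separated from `t, u` by facets. -/
theorem comb (d n t u v : ℤ) (hd : 3 ≤ d) (hn : d ≤ n) (ht2 : 2 ≤ t) (htn : t ≤ n - 1)
    (hu0 : 0 ≤ u) (hun : u ≤ n) (hv0 : 0 ≤ v) (hvn : v ≤ n) (hvt : v ≠ t) (hvu : v ≠ u)
    (h : u = 0 ∨ (t - d + 1 ≤ u ∧ u ≤ t + d - 1 ∧ u ≠ t)) :
    (∃ i, 0 ≤ i ∧ i ≤ n - d + 1 ∧ (i ≤ t ∧ t ≤ i + d - 1) ∧ (i ≤ u ∧ u ≤ i + d - 1) ∧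
      ¬ (i ≤ v ∧ v ≤ i + d - 1)) ∨
    (∃ j, 2 ≤ j ∧ j ≤ n ∧
      (t = 0 ∨ (j - (d - 2) ≤ t ∧ t ≤ j + (d - 2) ∧ (t ≠ j ∨ j = n))) ∧
      (u = 0 ∨ (j - (d - 2) ≤ u ∧ u ≤ j + (d - 2) ∧ (u ≠ j ∨ j = n))) ∧
      ¬ (v = 0 ∨ (j - (d - 2) ≤ v ∧ v ≤ j + (d - 2) ∧ (v ≠ j ∨ j = n)))) := by
  by_cases hu : u = 0
  · by_cases hlt : v < t
    · by_cases h1 : t + d - 2 ≤ n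
      · exact Or.inr ⟨t + d - 2, by omega⟩
      · by_cases h2 : v < n - d + 2
        · exact Or.inr ⟨n, by omega⟩
        · exact Or.inr ⟨v, by omega⟩
    · by_cases h1 : t ≤ d - 1
      · by_cases h2 : v ≤ d - 1
        · exact Or.inr ⟨v, by omega⟩
        · exact Or.inl ⟨0, by omega⟩
      · exact Or.inr ⟨t - d + 2, by omega⟩
  · obtain ⟨a, b, ha1, hab, hbn, hbd, hor⟩ : ∃ a b : ℤ, 1 ≤ a ∧ a < b ∧ b ≤ n ∧ b - a ≤ d - 1 ∧
        ((t = a ∧ u = b) ∨ (t = b ∧ u = a)) := by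
      rcases lt_or_ge t u with h1 | h1
      · exact ⟨t, u, by omega⟩
      · exact ⟨u, t, by omega⟩
    by_cases hva : v < a
    · by_cases h1 : a ≤ n - d + 1
      · exact Or.inl ⟨a, by omega⟩
      · by_cases h2 : v < n - d + 1
        · exact Or.inl ⟨n - d + 1, by omega⟩
        · by_cases h3 : v = n - d + 1
          · exact Or.inr ⟨n, by omega⟩
          · exact Or.inr ⟨v, by omega⟩
    · by_cases hvb : v < b
      · exact Or.inr ⟨v, by omega⟩
      · by_cases h1 : d - 1 ≤ b
        · exact Or.inl ⟨b - d + 1, by omega⟩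
        · by_cases h2 : v ≤ d - 1
          · exact Or.inr ⟨v, by omega⟩
          · exact Or.inl ⟨0, by omega⟩

/-- In a `d`-braxtope, for `2 ≤ t ≤ n - 1`, `[x_t, x_u]` is an edge iff
`u = 0`, or `t - d + 1 ≤ u ≤ t + d - 1` with `u ≠ t`. -/
theorem braxtope_middle_edges (d n : ℕ) (hd : 3 ≤ d) (hn : d ≤ n)
    (x : Fin (n + 1) → V) (hx : IsBraxtope d n x)
    (t : Fin (n + 1)) (ht2 : 2 ≤ (t : ℕ)) (htn : (t : ℕ) ≤ n - 1)
    (u : Fin (n + 1)) :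
    IsEdgeOf (braxQ x) (x t) (x u) ↔
      (u : ℕ) = 0 ∨
        (((t : ℕ) : ℤ) - d + 1 ≤ ((u : ℕ) : ℤ) ∧
          ((u : ℕ) : ℤ) ≤ ((t : ℕ) : ℤ) + d - 1 ∧ u ≠ t) := by
  have htlt := t.2
  have hult := u.2
  obtain ⟨-, hinj, hdim, hext, hfac⟩ := hx.2 hd
  have hQ : ∀ i, x i ∈ braxQ x := fun i => subset_convexHull ℝ _ ⟨i, rfl⟩
  have hsd : u ≠ t → sdim (segment ℝ (x t) (x u)) = 1 := by
    intro hne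
    rw [sdim, if_pos ⟨_, left_mem_segment ℝ _ _⟩, direction_affineSpan, vectorSpan_segment,
      finrank_span_singleton]
    · rfl
    · rw [vsub_eq_sub, sub_ne_zero]
      exact fun h => hne (hinj h)
  constructor
  · rintro ⟨⟨hE, -, -⟩, hs⟩
    by_cases hu0 : (u : ℕ) = 0
    · exact Or.inl hu0
    right
    have hut : u ≠ t := by
      rintro rfl
      rw [sdim, if_pos ⟨_, left_mem_segment ℝ _ _⟩, direction_affineSpan, vectorSpan_segment, vsub_self,
        Submodule.span_zero_singleton, finrank_bot] at hs
      simp at hs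
    have h0 : x 0 ∉ segment ℝ (x t) (x u) := by
      rw [← convexHull_pair]
      intro h
      have hsub : convexHull ℝ {x t, x u} ⊆ braxQ x := by
        rw [convexHull_pair]; exact hE.subset
      rcases vertex_mem hsub (hext 0) h with h1 | h1
      · have := hinj h1
        rw [← this] at ht2
        simp at ht2
      · have := hinj h1
        rw [← this] at hu0
        simp at hu0
    obtain ⟨f0, hf1, hf2, hf3⟩ := edge_functional x t u 0 hE h0
    obtain ⟨F, hF, htF, huF, h0F⟩ := facet_exists d x hdim t u 0 f0 hf1 hf2 hf3
    have hFQ : F ⊆ braxQ x := hF.1.1.subset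
    rcases (hfac F).1 hF with ⟨i, hi0, hi1, rfl⟩ | ⟨j, hj0, hj1, rfl⟩
    · have h1 := (mem_Tset hinj hi0 hi1 t).1 (vertex_mem hFQ (hext t) htF)
      have h2 := (mem_Tset hinj hi0 hi1 u).1 (vertex_mem hFQ (hext u) huF)
      refine ⟨by omega, by omega, hut⟩
    · exact absurd (subset_convexHull ℝ _ (Set.mem_insert _ _)) h0F
  · intro h
    have hut : u ≠ t := by
      rcases h with h | h
      · rintro rfl
        omega
      · exact h.2.2
    refine ⟨⟨?_, convex_segment _ _, ?_⟩, hsd hut⟩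
    swap
    · rw [← convexHull_pair]
      exact ((Set.toFinite _).isCompact_convexHull ℝ).isClosed
    set C : Set (Set V) :=
      {F | (F = braxQ x ∨ IsFacetOf d (braxQ x) F) ∧ x t ∈ F ∧ x u ∈ F} with hC
    have hQc : IsCompact (braxQ x) := (Set.finite_range x).isCompact_convexHull ℝ
    have hface : ∀ F ∈ C, IsExtreme ℝ (braxQ x) F ∧ Convex ℝ F ∧ IsClosed F := by
      rintro F ⟨rfl | hF, -⟩
      · exact ⟨IsExtreme.rfl, convex_convexHull ℝ _, hQc.isClosed⟩
      · exact hF.1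
    have hQC : braxQ x ∈ C := ⟨Or.inl rfl, hQ t, hQ u⟩
    have hGe : IsExtreme ℝ (braxQ x) (⋂₀ C) :=
      isExtreme_sInter ⟨_, hQC⟩ fun F hF => (hface F hF).1
    have hGc : IsCompact (⋂₀ C) :=
      hQc.of_isClosed_subset (isClosed_sInter fun F hF => (hface F hF).2.2) hGe.subset
    have hGv : Convex ℝ (⋂₀ C) := convex_sInter fun F hF => (hface F hF).2.1
    have hGs : ⋂₀ C = segment ℝ (x t) (x u) := by
      apply Set.Subset.antisymm
      · rw [← closure_convexHull_extremePoints hGc hGv, ← convexHull_pair]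
        refine closure_minimal (convexHull_mono ?_)
          ((Set.toFinite _).isCompact_convexHull ℝ).isClosed
        intro p hp
        obtain ⟨v, rfl⟩ := extremePoints_convexHull_subset
          (hGe.extremePoints_subset_extremePoints hp)
        have hvlt := v.2
        by_contra hcon
        rw [Set.mem_insert_iff, Set.mem_singleton_iff, not_or] at hcon
        have hvt : v ≠ t := fun h => hcon.1 (by rw [h])
        have hvu : v ≠ u := fun h => hcon.2 (by rw [h])
        have hvC : ∀ F ∈ C, x v ∈ F := fun F hF => hp.1 F hF
        have hvt' := Fin.val_ne_of_ne hvt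
        have hvu' := Fin.val_ne_of_ne hvu
        have hut' := Fin.val_ne_of_ne hut
        rcases comb d n (t : ℕ) (u : ℕ) (v : ℕ) (by omega) (by omega) (by omega) (by omega)
          (by omega) (by omega) (by omega) (by omega) (by omega) (by omega)
          (by omega) with ⟨i, hi0, hi1, hit, hiu, hiv⟩ | ⟨j, hj0, hj1, hjt, hju, hjv⟩
        · have hF := (hfac _).2 (Or.inl ⟨i, hi0, hi1, rfl⟩)
          have hm := hvC _ ⟨Or.inr hF,
            subset_convexHull ℝ _ ((mem_Tset hinj hi0 hi1 t).2 hit),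
            subset_convexHull ℝ _ ((mem_Tset hinj hi0 hi1 u).2 hiu)⟩
          exact hiv ((mem_Tset hinj hi0 hi1 v).1 (vertex_mem hF.1.1.subset (hext v) hm))
        · have hF := (hfac _).2 (Or.inr ⟨j, hj0, hj1, rfl⟩)
          have hm := hvC _ ⟨Or.inr hF,
            subset_convexHull ℝ _ ((mem_Eset hd hinj hj0 hj1 t).2 (by exact_mod_cast hjt)),
            subset_convexHull ℝ _ ((mem_Eset hd hinj hj0 hj1 u).2 (by exact_mod_cast hju))⟩
          have := (mem_Eset hd hinj hj0 hj1 v).1 (vertex_mem hF.1.1.subset (hext v) hm)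
          exact hjv (by exact_mod_cast this)
      · exact hGv.segment_subset (fun F hF => hF.2.1) (fun F hF => hF.2.2)
    rw [← hGs]
    exact hGe
end
end

section
/- For every n ≥ d ≥ 3, there exists a d-braxtope Q^{d,n} realized as a convex polytope in R^d; that is, there exist points x_0, ..., x_n in R^d whose convex hull is a d-polytope whose facets are exactly the sets T_i = [x_i, ..., x_{i+d-1}] (0 ≤ i ≤ n-d+1) and E_j = [x_0, x_{j-(d-2)}, ..., x_{j-1}, x_{j+1}, ..., x_{j+(d-2)}] (2 ≤ j ≤ n). -/
open Set

noncomputable section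

variable {V : Type*} [NormedAddCommGroup V] [NormedSpace ℝ V]

/-- Solutions of the linear recurrence used to build the vertex array. -/
def BRec (d : ℕ) (t : ℝ) (u : ℤ → ℝ) : Prop :=
  ∀ k : ℤ, u (k + d) = 3 * u (k + d - 1) + 3 * u (k + 1) - 7 * u k + 2 * t

lemma BRec.unique {d : ℕ} (hd : 3 ≤ d) {u : ℤ → ℝ} (hu : BRec d 0 u) (i : ℤ)
    (h : ∀ k, i ≤ k → k ≤ i + d - 1 → u k = 0) : ∀ k, u k = 0 := by
  have key : ∀ N : ℕ, ∀ k, i - N ≤ k → k ≤ i + d - 1 + N → u k = 0 := by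
    intro N
    induction N with
    | zero => intro k h1 h2; exact h k (by simpa using h1) (by simpa using h2)
    | succ N ih =>
      intro k h1 h2
      push_cast at h1 h2
      by_cases c1 : k < i - N
      · have hk : k = i - N - 1 := by omega
        have := hu k
        rw [ih (k + d) (by omega) (by omega), ih (k + d - 1) (by omega) (by omega),
          ih (k + 1) (by omega) (by omega)] at this
        linarith
      · by_cases c2 : i + d - 1 + N < k
        · have := hu (k - d)
          rw [ih (k - d + d - 1) (by omega) (by omega), ih (k - d + 1) (by omega) (by omega),
            ih (k - d) (by omega) (by omega)] at this
          simpa using this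
        · exact ih k (by omega) (by omega)
  intro k
  exact key ((k - i).natAbs) k (by omega) (by omega)

/-- The shift on windows of solutions. -/
def bshift (e : ℕ) (he : 2 ≤ e) : Equiv.Perm (Fin (e + 1) → ℝ) where
  toFun g := Fin.snoc (α := fun _ => ℝ) (Fin.tail g)
    (3 * g ⟨e, by omega⟩ + 3 * g ⟨1, by omega⟩ - 7 * g 0)
  invFun h := Fin.cons (α := fun _ => ℝ)
    ((3 * h ⟨e - 1, by omega⟩ + 3 * h 0 - h ⟨e, by omega⟩) / 7) (Fin.init h)
  left_inv g := by
    have h1 : (Fin.snoc (α := fun _ => ℝ) (Fin.tail g)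
      (3 * g ⟨e, by omega⟩ + 3 * g ⟨1, by omega⟩ - 7 * g 0) : Fin (e+1) → ℝ) ⟨e - 1, by omega⟩
        = g ⟨e, by omega⟩ := by
      have : (⟨e - 1, by omega⟩ : Fin (e + 1)) = Fin.castSucc ⟨e - 1, by omega⟩ := rfl
      rw [this, Fin.snoc_castSucc, Fin.tail]
      congr 1
      ext; simp; omega
    have h2 : (Fin.snoc (α := fun _ => ℝ) (Fin.tail g)
      (3 * g ⟨e, by omega⟩ + 3 * g ⟨1, by omega⟩ - 7 * g 0) : Fin (e+1) → ℝ) 0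
        = g ⟨1, by omega⟩ := by
      have : (0 : Fin (e + 1)) = Fin.castSucc ⟨0, by omega⟩ := rfl
      rw [this, Fin.snoc_castSucc, Fin.tail]
      rfl
    have h3 : (Fin.snoc (α := fun _ => ℝ) (Fin.tail g)
      (3 * g ⟨e, by omega⟩ + 3 * g ⟨1, by omega⟩ - 7 * g 0) : Fin (e+1) → ℝ) ⟨e, by omega⟩
        = 3 * g ⟨e, by omega⟩ + 3 * g ⟨1, by omega⟩ - 7 * g 0 := by
      have : (⟨e, by omega⟩ : Fin (e + 1)) = Fin.last e := rfl
      rw [this, Fin.snoc_last]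
    simp only [h1, h2, h3, Fin.init_snoc]
    have : (3 * g ⟨e, by omega⟩ + 3 * g ⟨1, by omega⟩ -
      (3 * g ⟨e, by omega⟩ + 3 * g ⟨1, by omega⟩ - 7 * g 0)) / 7 = g 0 := by ring
    rw [this, Fin.cons_self_tail]
  right_inv h := by
    have h1 : (Fin.cons (α := fun _ => ℝ)
      ((3 * h ⟨e - 1, by omega⟩ + 3 * h 0 - h ⟨e, by omega⟩) / 7) (Fin.init h) : Fin (e+1) → ℝ)
        ⟨e, by omega⟩ = h ⟨e - 1, by omega⟩ := by
      have : (⟨e, by omega⟩ : Fin (e + 1)) = Fin.succ ⟨e - 1, by omega⟩ := by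
        ext; simp; omega
      rw [this, Fin.cons_succ]; rfl
    have h2 : (Fin.cons (α := fun _ => ℝ)
      ((3 * h ⟨e - 1, by omega⟩ + 3 * h 0 - h ⟨e, by omega⟩) / 7) (Fin.init h) : Fin (e+1) → ℝ)
        ⟨1, by omega⟩ = h 0 := by
      have : (⟨1, by omega⟩ : Fin (e + 1)) = Fin.succ ⟨0, by omega⟩ := rfl
      rw [this, Fin.cons_succ]; rfl
    simp only [h1, h2, Fin.cons_zero, Fin.tail_cons]
    have : 3 * h ⟨e - 1, by omega⟩ + 3 * h 0 -
      7 * ((3 * h ⟨e - 1, by omega⟩ + 3 * h 0 - h ⟨e, by omega⟩) / 7) = h (Fin.last e) := by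
      have : (⟨e, by omega⟩ : Fin (e + 1)) = Fin.last e := rfl
      rw [this]; ring
    rw [this, Fin.snoc_init_self]

lemma BRec.exists0 {d : ℕ} (hd : 3 ≤ d) (g : ℕ → ℝ) :
    ∃ u : ℤ → ℝ, BRec d 0 u ∧ ∀ m : ℕ, m < d → u m = g m := by
  obtain ⟨e, rfl⟩ : ∃ e, d = e + 1 := ⟨d - 1, by omega⟩
  have he : 2 ≤ e := by omega
  set A := bshift e he with hA
  set g0 : Fin (e + 1) → ℝ := fun m => g m with hg0
  set u : ℤ → ℝ := fun k => (A ^ k) g0 0 with hu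
  have hAs : ∀ k : ℤ, (A ^ (k + 1)) g0 = A ((A ^ k) g0) := by
    intro k
    rw [add_comm k 1, zpow_add, zpow_one]; rfl
  have hAm : ∀ (y : Fin (e + 1) → ℝ) (m : ℕ) (hm : m < e),
      A y ⟨m, by omega⟩ = y ⟨m + 1, by omega⟩ := by
    intro y m hm
    have : (⟨m, by omega⟩ : Fin (e + 1)) = Fin.castSucc ⟨m, hm⟩ := rfl
    rw [this]
    simp only [hA, bshift, Equiv.coe_fn_mk, Fin.snoc_castSucc, Fin.tail]
    rfl
  have hAl : ∀ (y : Fin (e + 1) → ℝ), A y ⟨e, by omega⟩ =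
      3 * y ⟨e, by omega⟩ + 3 * y ⟨1, by omega⟩ - 7 * y 0 := by
    intro y
    have : (⟨e, by omega⟩ : Fin (e + 1)) = Fin.last e := rfl
    rw [this]
    simp only [hA, bshift, Equiv.coe_fn_mk, Fin.snoc_last]
    rfl
  have hwin : ∀ (m : ℕ) (hm : m < e + 1) (k : ℤ), (A ^ k) g0 ⟨m, hm⟩ = u (k + m) := by
    intro m
    induction m with
    | zero => intro hm k; simp [hu]
    | succ m ih =>
      intro hm k
      rw [← hAm ((A ^ k) g0) m (by omega), ← hAs, ih (by omega)]
      congr 1; push_cast; ring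
  refine ⟨u, ?_, ?_⟩
  · intro k
    have h := hAl ((A ^ k) g0)
    rw [← hAs, hwin, hwin, hwin] at h
    have h0 : (A ^ k) g0 0 = u k := rfl
    rw [h0] at h
    have e1 : k + ((e + 1 : ℕ) : ℤ) = k + 1 + e := by push_cast; ring
    have e2 : k + 1 + (e : ℤ) - 1 = k + e := by ring
    rw [e1, e2, h]; simp
  · intro m hm
    have := hwin m hm 0
    simp only [zpow_zero, zero_add] at this
    rw [← this]; rfl

lemma BRec.existsAt {d : ℕ} (hd : 3 ≤ d) (t : ℝ) (i : ℤ) (g : ℤ → ℝ) :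
    ∃ u : ℤ → ℝ, BRec d t u ∧ ∀ k : ℤ, i ≤ k → k ≤ i + d - 1 → u k = g k := by
  obtain ⟨u, hu, hg⟩ := BRec.exists0 hd (fun m => g (i + m) - t)
  refine ⟨fun k => u (k - i) + t, ?_, ?_⟩
  · intro k
    have := hu (k - i)
    have e1 : k + d - i = k - i + d := by ring
    have e2 : k + d - 1 - i = k - i + d - 1 := by ring
    have e3 : k + 1 - i = k - i + 1 := by ring
    simp only [e1, e2, e3, this]
    ring
  · intro k h1 h2
    have := hg (k - i).toNat (by omega)
    have e : (((k - i).toNat : ℕ) : ℤ) = k - i := by omega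
    rw [e] at this
    simp [this]

lemma exists_curve {d : ℕ} (hd : 3 ≤ d) : ∃ X : ℤ → EuclideanSpace ℝ (Fin d),
    (∀ (t : ℝ) (f : EuclideanSpace ℝ (Fin d) →ₗ[ℝ] ℝ), BRec d t (fun k => t + f (X k))) ∧
    (∀ (t : ℝ) (u : ℤ → ℝ), BRec d t u →
      ∃ f : EuclideanSpace ℝ (Fin d) →ₗ[ℝ] ℝ, ∀ k, t + f (X k) = u k) ∧
    (∀ (f : EuclideanSpace ℝ (Fin d) →ₗ[ℝ] ℝ) (i : ℤ),
      (∀ k, i ≤ k → k ≤ i + d - 1 → f (X k) = 0) → f = 0) := by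
  choose s hs hs' using fun m : Fin d => BRec.exists0 hd (fun r => if r = (m : ℕ) then 1 else 0)
  set X : ℤ → EuclideanSpace ℝ (Fin d) := fun k => WithLp.toLp 2 (fun m => s m k) with hX
  have hXrec : ∀ k : ℤ, X (k + d) =
      (3 : ℝ) • X (k + d - 1) + (3 : ℝ) • X (k + 1) - (7 : ℝ) • X k := by
    intro k
    ext m
    simp [hX, hs m k]
  have hXb : ∀ m : Fin d, X (m : ℕ) = EuclideanSpace.single m (1 : ℝ) := by
    intro m
    ext r
    simp only [hX, hs' r m m.2, PiLp.single_apply, Fin.ext_iff]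
    simp [eq_comm]
  have hrec : ∀ (t : ℝ) (f : EuclideanSpace ℝ (Fin d) →ₗ[ℝ] ℝ),
      BRec d t (fun k => t + f (X k)) := by
    intro t f k
    simp only [hXrec k, map_add, map_sub, map_smul, smul_eq_mul]
    ring
  refine ⟨X, hrec, ?_, ?_⟩
  · intro t u hu
    let f : EuclideanSpace ℝ (Fin d) →ₗ[ℝ] ℝ :=
      (EuclideanSpace.basisFun (Fin d) ℝ).toBasis.constr ℝ (fun m => u (m : ℕ) - t)
    have hf : ∀ m : Fin d, f (X (m : ℕ)) = u (m : ℕ) - t := by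
      intro m
      have := (EuclideanSpace.basisFun (Fin d) ℝ).toBasis.constr_basis ℝ
        (fun m : Fin d => u (m : ℕ) - t) m
      rw [hXb, ← this]
      simp [f]
    refine ⟨f, ?_⟩
    have hz : BRec d 0 (fun k => t + f (X k) - u k) := by
      intro k
      have h1 := hrec t f k
      have h2 := hu k
      simp only at h1
      simp only [h1, h2]; ring
    have := BRec.unique hd hz 0 (by
      intro k h1 h2
      have := hf ⟨k.toNat, by omega⟩
      have e : ((k.toNat : ℕ) : ℤ) = k := by omega
      simp only [e] at this
      simp [this])
    intro k
    have := this k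
    linarith
  · intro f i h
    have h0 := BRec.unique hd (hrec 0 f) i (by simpa using h)
    apply (EuclideanSpace.basisFun (Fin d) ℝ).toBasis.ext
    intro m
    have := h0 (m : ℕ)
    simp only [hXb] at this
    simpa using this

lemma BRec.w {d : ℕ} {t : ℝ} {v : ℤ → ℝ} (hv : BRec d t v) (k : ℤ) :
    v (k + 1 + d - 1) - 3 * v (k + 1) = 3 * (v (k + d - 1) - 3 * v k) + 2 * v k + 2 * t := by
  have := hv k
  have e : k + 1 + (d : ℤ) - 1 = k + d := by ring
  rw [e, this]; ring

lemma BRec.fwd {d : ℕ} (hd : 3 ≤ d) {t : ℝ} (ht : 0 ≤ t) {v : ℤ → ℝ} (hv : BRec d t v) (j : ℤ)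
    (hw : 0 < v (j + d - 1) - 3 * v j) (h : ∀ k, j ≤ k → k ≤ j + d - 2 → 0 ≤ v k) :
    ∀ k, j + d - 1 ≤ k → 0 < v k := by
  have key : ∀ N : ℕ, 0 < v (j + N + d - 1) - 3 * v (j + N) ∧
      (∀ k, j ≤ k → k ≤ j + d - 2 + N → 0 ≤ v k) ∧
      (∀ k, j + d - 1 ≤ k → k ≤ j + d - 2 + N → 0 < v k) := by
    intro N
    induction N with
    | zero =>
      refine ⟨by simpa using hw, by simpa using h, ?_⟩
      intro k h1 h2; push_cast at h2; omega
    | succ N ih =>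
      obtain ⟨i1, i2, i3⟩ := ih
      have hn : 0 ≤ v (j + N) := i2 _ (by omega) (by omega)
      have hp : 0 < v (j + N + d - 1) := by linarith
      have i3' : ∀ k, j + d - 1 ≤ k → k ≤ j + d - 2 + ((N + 1 : ℕ) : ℤ) → 0 < v k := by
        intro k h1 h2
        push_cast at h2
        by_cases c : k ≤ j + d - 2 + N
        · exact i3 k h1 c
        · have : k = j + N + d - 1 := by omega
          rw [this]; exact hp
      refine ⟨?_, ?_, i3'⟩
      · have := hv.w (j + N)
        push_cast
        rw [← add_assoc, this]
        linarith
      · intro k h1 h2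
        by_cases c : j + d - 1 ≤ k
        · exact (i3' k c h2).le
        · exact h k h1 (by omega)
  intro k hk
  exact (key (k - (j + d - 2)).toNat).2.2 k hk (by omega)

lemma BRec.bwd {d : ℕ} (hd : 3 ≤ d) {t : ℝ} (ht : 0 ≤ t) {v : ℤ → ℝ} (hv : BRec d t v) (j : ℤ)
    (hw : v (j + d - 1) - 3 * v j < 0) (h : ∀ k, j + 1 ≤ k → k ≤ j + d - 1 → 0 ≤ v k) :
    ∀ k, k ≤ j → 0 < v k := by
  have key : ∀ N : ℕ, v (j - N + d - 1) - 3 * v (j - N) < 0 ∧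
      (∀ k, j - N ≤ k → k ≤ j + d - 1 → 0 ≤ v k) ∧
      (∀ k, j - N ≤ k → k ≤ j → 0 < v k) := by
    intro N
    induction N with
    | zero =>
      have hj : 0 < v j := by
        have := h (j + d - 1) (by omega) (by omega)
        linarith
      refine ⟨by simpa using hw, ?_, ?_⟩
      · intro k h1 h2
        by_cases c : k = j
        · rw [c]; exact hj.le
        · push_cast at h1
          exact h k (by omega) h2
      · intro k h1 h2
        push_cast at h1
        have : k = j := by omega
        rw [this]; exact hj
    | succ N ih =>
      obtain ⟨i1, i2, i3⟩ := ih
      have hn : 0 ≤ v (j - (N + 1) + d - 1) := i2 _ (by omega) (by omega)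
      have hww := hv.w (j - (N + 1))
      have e1 : j - ((N : ℤ) + 1) + 1 = j - N := by ring
      rw [e1] at hww
      have hw' : v (j - (N + 1) + d - 1) - 3 * v (j - (N + 1)) < 0 := by linarith
      have hp : 0 < v (j - (N + 1)) := by linarith
      refine ⟨by push_cast; exact hw', ?_, ?_⟩
      · intro k h1 h2
        push_cast at h1
        by_cases c : k = j - (N + 1)
        · rw [c]; exact hp.le
        · exact i2 k (by omega) h2
      · intro k h1 h2
        push_cast at h1
        by_cases c : k = j - (N + 1)
        · rw [c]; exact hp
        · exact i3 k (by omega) h2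
  intro k hk
  exact (key (j - k).toNat).2.2 k (by omega) hk

/-- The functional of `T_i`, `i ≥ 1`. -/
lemma seqT {d : ℕ} (hd : 3 ≤ d) (i : ℤ) : ∃ v, BRec d 1 v ∧
    (∀ k, i ≤ k → k ≤ i + d - 1 → v k = 0) ∧ (∀ k, (k < i ∨ i + d - 1 < k) → 0 < v k) := by
  obtain ⟨v, hv, hg⟩ := BRec.existsAt hd 1 i (fun _ => 0)
  refine ⟨v, hv, hg, ?_⟩
  rintro k (hk | hk)
  · refine hv.bwd hd zero_le_one (i - 1) ?_ ?_ k (by omega)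
    · have := hv (i - 1)
      rw [hg (i - 1 + d) (by omega) (by omega), hg (i - 1 + d - 1) (by omega) (by omega),
        hg (i - 1 + 1) (by omega) (by omega)] at this
      rw [hg (i - 1 + d - 1) (by omega) (by omega)]
      linarith
    · intro k h1 h2
      exact (hg k (by omega) (by omega)).ge
  · refine hv.fwd hd zero_le_one (i + 1) ?_ ?_ k (by omega)
    · rw [hv.w, hg i (by omega) (by omega), hg (i + d - 1) (by omega) (by omega)]
      norm_num
    · intro k h1 h2
      exact (hg k (by omega) (by omega)).ge

/-- The functional of `T_0`. -/
lemma seqT0 {d : ℕ} (hd : 3 ≤ d) : ∃ v, BRec d 0 v ∧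
    (∀ k, 1 ≤ k → k ≤ (d : ℤ) - 1 → v k = 0) ∧ (∀ k, (d : ℤ) ≤ k → 0 < v k) := by
  obtain ⟨v, hv, hg⟩ := BRec.existsAt hd 0 1 (fun k => if k = d then 1 else 0)
  refine ⟨v, hv, ?_, ?_⟩
  · intro k h1 h2
    rw [hg k h1 (by omega), if_neg (by omega)]
  · intro k hk
    refine hv.fwd hd le_rfl 1 ?_ ?_ k (by omega)
    · rw [hg _ (by omega) (by omega), hg _ (by omega) (by omega), if_pos (by omega),
        if_neg (by omega)]
      norm_num
    · intro k h1 h2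
      rw [hg k (by omega) (by omega)]
      split_ifs <;> norm_num

/-- The functional of `E_n`. -/
lemma seqEn {d : ℕ} (hd : 3 ≤ d) (n : ℤ) : ∃ v, BRec d 0 v ∧
    (∀ k, n - d + 2 ≤ k → k ≤ n → v k = 0) ∧ (∀ k, k ≤ n - d + 1 → 0 < v k) := by
  obtain ⟨v, hv, hg⟩ := BRec.existsAt hd 0 (n - d + 1) (fun k => if k = n - d + 1 then 1 else 0)
  refine ⟨v, hv, ?_, ?_⟩
  · intro k h1 h2
    rw [hg k (by omega) (by omega), if_neg (by omega)]
  · intro k hk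
    refine hv.bwd hd le_rfl (n - d + 1) ?_ ?_ k (by omega)
    · rw [hg _ (by omega) (by omega), hg _ (by omega) (by omega), if_neg (by omega),
        if_pos (by omega)]
      norm_num
    · intro k h1 h2
      rw [hg k (by omega) (by omega)]
      split_ifs <;> norm_num

/-- The functional of `E_j`. -/
lemma seqE {d : ℕ} (hd : 3 ≤ d) (j : ℤ) : ∃ v, BRec d 0 v ∧
    (∀ k, j - d + 2 ≤ k → k ≤ j + d - 2 → k ≠ j → v k = 0) ∧
    (∀ k, (k < j - d + 2 ∨ j + d - 2 < k ∨ k = j) → 0 < v k) := by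
  obtain ⟨v, hv, hg⟩ := BRec.existsAt hd 0 (j - d + 2) (fun k => if k = j then 1 else 0)
  have hj : v j = 1 := by rw [hg j (by omega) (by omega), if_pos rfl]
  have hz : ∀ N : ℕ, ∀ k, j - d + 2 ≤ k → k ≤ j + 1 + N → k ≤ j + d - 2 → k ≠ j → v k = 0 := by
    intro N
    induction N with
    | zero =>
      intro k h1 h2 h3 h4
      push_cast at h2
      rw [hg k (by omega) (by omega), if_neg h4]
    | succ N ih =>
      intro k h1 h2 h3 h4
      push_cast at h2
      by_cases c : k ≤ j + 1 + N
      · exact ih k h1 c h3 h4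
      · have := hv (k - d)
        rw [ih (k - d + d - 1) (by omega) (by omega) (by omega) (by omega),
          ih (k - d + 1) (by omega) (by omega) (by omega) (by omega),
          ih (k - d) (by omega) (by omega) (by omega) (by omega)] at this
        simpa using this
  have hz' : ∀ k, j - d + 2 ≤ k → k ≤ j + d - 2 → k ≠ j → v k = 0 :=
    fun k h1 h2 h3 => hz d k h1 (by omega) h2 h3
  have hnn : ∀ k, j - d + 2 ≤ k → k ≤ j + d - 2 → 0 ≤ v k := by
    intro k h1 h2
    by_cases c : k = j
    · rw [c, hj]; norm_num
    · exact (hz' k h1 h2 c).ge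
  have hj2 : v (j + d - 1) = 3 := by
    have := hv (j - 1)
    rw [hz' (j - 1 + d - 1) (by omega) (by omega) (by omega),
      hz' (j - 1) (by omega) (by omega) (by omega)] at this
    have e1 : j - 1 + (d : ℤ) = j + d - 1 := by ring
    have e2 : j - 1 + 1 = j := by ring
    rw [e1, e2, hj] at this
    linarith
  refine ⟨v, hv, hz', ?_⟩
  rintro k (hk | hk | hk)
  · refine hv.bwd hd le_rfl (j - d + 1) ?_ ?_ k (by omega)
    · have := hv (j - d + 1)
      have e1 : j - d + 1 + (d : ℤ) - 1 = j := by ring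
      rw [hz' (j - d + 1 + d) (by omega) (by omega) (by omega),
        hz' (j - d + 1 + 1) (by omega) (by omega) (by omega), e1, hj] at this
      rw [e1, hj]
      linarith
    · intro k h1 h2
      exact hnn k (by omega) (by omega)
  · by_cases c : k = j + d - 1
    · rw [c, hj2]; norm_num
    refine hv.fwd hd le_rfl (j + 1) ?_ ?_ k (by omega)
    · rw [hv.w, hj2, hj]
      norm_num
    · intro k h1 h2
      by_cases c : k = j + d - 1
      · rw [c, hj2]; norm_num
      · exact hnn k (by omega) (by omega)
  · rw [hk, hj]; norm_num

/-- A functional exposing `x_k`. -/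
lemma seqV {d : ℕ} (hd : 3 ≤ d) (j : ℤ) : ∃ v, BRec d 1 v ∧
    v j = 0 ∧ ∀ k, k ≠ j → 0 < v k := by
  obtain ⟨v, hv, hg⟩ := BRec.existsAt hd 1 (j - 1)
    (fun k => if k = j then 0 else if k = j + d - 2 then 3 else 1)
  have hj : v j = 0 := by rw [hg j (by omega) (by omega), if_pos rfl]
  have hj1 : v (j - 1) = 1 := by
    rw [hg _ (by omega) (by omega), if_neg (by omega), if_neg (by omega)]
  have hj2 : v (j + d - 2) = 3 := by
    rw [hg _ (by omega) (by omega), if_neg (by omega), if_pos (by omega)]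
  have hp : ∀ k, j - 1 ≤ k → k ≤ j + d - 2 → k ≠ j → 0 < v k := by
    intro k h1 h2 h3
    rw [hg _ (by omega) (by omega), if_neg h3]
    split_ifs <;> norm_num
  have hnn : ∀ k, j - 1 ≤ k → k ≤ j + d - 2 → 0 ≤ v k := by
    intro k h1 h2
    by_cases c : k = j
    · rw [c, hj]
    · exact (hp k h1 h2 c).le
  refine ⟨v, hv, hj, ?_⟩
  intro k hk
  rcases lt_or_ge k (j - 1) with c | c
  · refine hv.bwd hd zero_le_one (j - 2) ?_ ?_ k (by omega)
    · have := hv (j - 2)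
      have e1 : j - 2 + (d : ℤ) = j + d - 2 := by ring
      have e2 : j - 2 + 1 = j - 1 := by ring
      rw [e1, e2, hj1, hj2] at this
      have h3 := hnn (j + d - 2 - 1) (by omega) (by omega)
      rw [e1]
      linarith
    · intro k h1 h2
      exact hnn k (by omega) (by omega)
  · rcases le_or_gt k (j + d - 2) with c' | c'
    · exact hp k c c' hk
    · refine hv.fwd hd zero_le_one j ?_ ?_ k (by omega)
      · have := hv.w (j - 1)
        have e1 : j - 1 + 1 = j := by ring
        have e2 : j - 1 + (d : ℤ) - 1 = j + d - 2 := by ring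
        rw [e1, e2, hj1, hj2] at this
        rw [this]; norm_num
      · intro k h1 h2
        exact hnn k (by omega) (by omega)

/-- A functional exposing the apex. -/
lemma seqV0 {d : ℕ} (hd : 3 ≤ d) : ∃ v, BRec d 0 v ∧ ∀ k, 1 ≤ k → 0 < v k := by
  obtain ⟨v, hv, hg⟩ := BRec.existsAt hd 0 1 (fun k => if k = d then 4 else 1)
  refine ⟨v, hv, ?_⟩
  have hp : ∀ k, 1 ≤ k → k ≤ (d : ℤ) → 0 < v k := by
    intro k h1 h2
    rw [hg _ (by omega) (by omega)]
    split_ifs <;> norm_num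
  intro k hk
  rcases le_or_gt k d with c | c
  · exact hp k hk c
  · refine hv.fwd hd le_rfl 1 ?_ ?_ k (by omega)
    · rw [hg _ (by omega) (by omega), hg _ (by omega) (by omega), if_pos (by omega),
        if_neg (by omega)]
      norm_num
    · intro k h1 h2
      exact (hp k (by omega) (by omega)).le

/-- Rigidity between two distant zeros of a nonnegative solution. -/
lemma BRec.rigid {d : ℕ} {t : ℝ} (ht : 0 ≤ t) {v : ℤ → ℝ} (hv : BRec d t v)
    (p r : ℤ) (hp0 : v p = 0) (hr0 : v (r + d - 1) = 0)
    (hnn : ∀ k, p ≤ k → k ≤ r + d - 1 → 0 ≤ v k) (hpr : p ≤ r) (hd : 3 ≤ d) :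
    (∀ k, p ≤ k → k ≤ r → v (k + d - 1) - 3 * v k = 0) ∧
    (∀ k, p ≤ k → k < r → v k = 0 ∧ t = 0) := by
  have h1 : ∀ N : ℕ, p + N ≤ r → 0 ≤ v (p + N + d - 1) - 3 * v (p + N) := by
    intro N
    induction N with
    | zero =>
      intro _
      have := hnn (p + d - 1) (by omega) (by omega)
      simp [hp0, this]
    | succ N ih =>
      intro h
      push_cast at h ⊢
      have := ih (by omega)
      rw [← add_assoc, hv.w]
      have := hnn (p + N) (by omega) (by omega)
      linarith
  have h2 : ∀ N : ℕ, p ≤ r - N → v (r - N + d - 1) - 3 * v (r - N) ≤ 0 := by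
    intro N
    induction N with
    | zero =>
      intro _
      have := hnn r (by omega) (by omega)
      simp [hr0, this]
    | succ N ih =>
      intro h
      push_cast at h ⊢
      have i := ih (by omega)
      have hw := hv.w (r - (N + 1))
      have e : r - ((N : ℤ) + 1) + 1 = r - N := by ring
      rw [e] at hw
      have := hnn (r - (N + 1)) (by omega) (by omega)
      linarith
  have h3 : ∀ k, p ≤ k → k ≤ r → v (k + d - 1) - 3 * v k = 0 := by
    intro k a b
    have e1 := h1 (k - p).toNat (by omega)
    have e2 := h2 (r - k).toNat (by omega)
    have f1 : p + (((k - p).toNat : ℕ) : ℤ) = k := by omega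
    have f2 : r - (((r - k).toNat : ℕ) : ℤ) = k := by omega
    rw [f1] at e1
    rw [f2] at e2
    linarith
  refine ⟨h3, ?_⟩
  intro k a b
  have hw := hv.w k
  rw [h3 k a b.le, h3 (k + 1) (by omega) (by omega)] at hw
  have := hnn k a (by omega)
  constructor <;> linarith

lemma exists_extremes (n : ℤ) (P : ℤ → Prop) (h : ∃ k, 1 ≤ k ∧ k ≤ n ∧ P k) :
    ∃ p q, 1 ≤ p ∧ p ≤ q ∧ q ≤ n ∧ P p ∧ P q ∧ ∀ k, 1 ≤ k → k ≤ n → P k → p ≤ k ∧ k ≤ q := by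
  classical
  set S := (Finset.Icc 1 n).filter P with hS
  have hne : S.Nonempty := by
    obtain ⟨k, h1, h2, h3⟩ := h
    exact ⟨k, by simp [hS, h1, h2, h3]⟩
  have hp := S.min'_mem hne
  have hq := S.max'_mem hne
  have hpq := S.min'_le_max' hne
  refine ⟨S.min' hne, S.max' hne, ?_, hpq, ?_, ?_, ?_, ?_⟩
  · simp only [hS, Finset.mem_filter, Finset.mem_Icc] at hp; exact hp.1.1
  · simp only [hS, Finset.mem_filter, Finset.mem_Icc] at hq; exact hq.1.2
  · simp only [hS, Finset.mem_filter, Finset.mem_Icc] at hp; exact hp.2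
  · simp only [hS, Finset.mem_filter, Finset.mem_Icc] at hq; exact hq.2
  · intro k h1 h2 h3
    have : k ∈ S := by simp [hS, h1, h2, h3]
    exact ⟨S.min'_le k this, S.le_max' k this⟩

/-- Zero sets of positive affine functionals not vanishing at the apex. -/
lemma zerosT {d n : ℕ} (hd : 3 ≤ d) (hn : d ≤ n) {t : ℝ} (ht : 0 < t) {v : ℤ → ℝ}
    (hv : BRec d t v) (hnn : ∀ k, 1 ≤ k → k ≤ (n : ℤ) → 0 ≤ v k) :
    ∃ i : ℤ, 1 ≤ i ∧ i ≤ n - d + 1 ∧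
      ∀ k, 1 ≤ k → k ≤ (n : ℤ) → v k = 0 → i ≤ k ∧ k ≤ i + d - 1 := by
  by_cases hz : ∃ k, 1 ≤ k ∧ k ≤ (n : ℤ) ∧ v k = 0
  · obtain ⟨p, q, h1, h2, h3, h4, h5, h6⟩ := exists_extremes n (fun k => v k = 0) hz
    have hpq : q ≤ p + d - 1 := by
      by_contra hc
      have := (hv.rigid ht.le p (q - d + 1) h4 (by
        have : q - d + 1 + (d : ℤ) - 1 = q := by ring
        rw [this]; exact h5) (fun k a b => hnn k (by omega) (by omega)) (by omega) hd).2 p le_rfl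
        (by omega)
      linarith [this.2]
    by_cases c : p ≤ n - d + 1
    · refine ⟨p, h1, c, fun k a b e => ?_⟩
      have := h6 k a b e
      omega
    · refine ⟨n - d + 1, by omega, le_rfl, fun k a b e => ?_⟩
      have := h6 k a b e
      omega
  · refine ⟨1, le_rfl, by omega, fun k a b e => ?_⟩
    exact absurd ⟨k, a, b, e⟩ hz

/-- Zero sets of nonnegative functionals vanishing at the apex. -/
lemma zerosE {d n : ℕ} (hd : 3 ≤ d) (hn : d ≤ n) {v : ℤ → ℝ}
    (hv : BRec d 0 v) (hnn : ∀ k, 1 ≤ k → k ≤ (n : ℤ) → 0 ≤ v k) (hnz : ∃ k, v k ≠ 0) :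
    (∀ k, 1 ≤ k → k ≤ (n : ℤ) → v k = 0 → k ≤ d - 1) ∨
    (∀ k, 1 ≤ k → k ≤ (n : ℤ) → v k = 0 → n - d + 2 ≤ k) ∨
    ∃ j : ℤ, 2 ≤ j ∧ j ≤ (n : ℤ) - 1 ∧
      ∀ k, 1 ≤ k → k ≤ (n : ℤ) → v k = 0 → j - d + 2 ≤ k ∧ k ≤ j + d - 2 ∧ k ≠ j := by
  by_cases hz : ∃ k, 1 ≤ k ∧ k ≤ (n : ℤ) ∧ v k = 0
  swap
  · left
    intro k a b e
    exact absurd ⟨k, a, b, e⟩ hz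
  obtain ⟨p, q, h1, h2, h3, h4, h5, h6⟩ := exists_extremes n (fun k => v k = 0) hz
  by_cases c1 : q ≤ d - 1
  · left
    intro k a b e
    have := h6 k a b e
    omega
  right
  by_cases c2 : n - d + 2 ≤ p
  · left
    intro k a b e
    have := h6 k a b e
    omega
  right
  have suff : ∃ j, q - d + 2 ≤ j ∧ j ≤ p + d - 2 ∧ v j ≠ 0 := by
    by_contra hc
    push Not at hc
    obtain ⟨k0, hk0⟩ := hnz
    apply hk0
    by_cases c3 : p ≤ q - d + 1
    · obtain ⟨r1, r2⟩ := hv.rigid le_rfl p (q - d + 1) h4 (by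
        have : q - d + 1 + (d : ℤ) - 1 = q := by ring
        rw [this]; exact h5) (fun k a b => hnn k (by omega) (by omega)) (by omega) hd
      have r3 : ∀ k, p ≤ k → k ≤ q - d + 1 → v k = 0 := by
        intro k a b
        by_cases e : k = q - d + 1
        · have := r1 k a b
          have e2 : k + d - 1 = q := by omega
          rw [e2, h5] at this
          linarith
        · exact (r2 k a (by omega)).1
      apply hv.unique hd p
      intro k a b
      by_cases e : k ≤ q - d + 1
      · exact r3 k a e
      · by_cases e' : k ≤ p + d - 2
        · exact hc k (by omega) e'
        · have ek : k = p + d - 1 := by omega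
          have := r1 p le_rfl c3
          rw [ek]
          rw [h4] at this
          linarith
    · have hqp : q = p + d - 2 := by
        have hlo := h6 (q - d + 2) (by omega) (by omega) (hc _ le_rfl (by omega))
        have hhi := h6 (p + d - 2) (by omega) (by omega) (hc _ (by omega) le_rfl)
        omega
      have hr := hv (p - 1)
      have e1 : p - 1 + (d : ℤ) - 1 = p + d - 2 := by ring
      have e2 : p - 1 + 1 = p := by ring
      rw [e1, e2, h4, hc (p + d - 2) (by omega) le_rfl] at hr
      have g1 := hnn (p - 1) (by omega) (by omega)
      have g2 := hnn (p - 1 + d) (by omega) (by omega)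
      apply hv.unique hd (p - 1)
      intro k a b
      by_cases e : k = p - 1
      · rw [e]; linarith
      · exact hc k (by omega) (by omega)
  obtain ⟨j, j1, j2, j3⟩ := suff
  have hj2 : 2 ≤ j := by omega
  have hj3 : j ≤ n - 1 := by omega
  refine ⟨j, hj2, hj3, ?_⟩
  intro k a b e
  have := h6 k a b e
  refine ⟨by omega, by omega, ?_⟩
  rintro rfl
  exact j3 e

section Geometry

lemma face_eq {n : ℕ} (x : Fin (n + 1) → V) (t : ℝ) (f : V →ₗ[ℝ] ℝ)
    (h : ∀ k, 0 ≤ t + f (x k)) :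
    braxQ x ∩ {y | t + f y = 0} = convexHull ℝ (x '' {k | t + f (x k) = 0}) := by
  have hconv0 : ∀ y ∈ convexHull ℝ (x '' {k | t + f (x k) = 0}), t + f y = 0 := by
    have : convexHull ℝ (x '' {k | t + f (x k) = 0}) ⊆ {y | t + f y = 0} := by
      apply convexHull_min
      · rintro _ ⟨k, hk, rfl⟩; exact hk
      · intro y hy z hz a b _ _ hab
        simp only [mem_ofPred_eq, map_add, map_smul, smul_eq_mul] at *
        have : t = a * t + b * t := by rw [← add_mul, hab, one_mul]
        nlinarith
    exact this
  have hsub : braxQ x ⊆ {y | 0 < t + f y} ∪ convexHull ℝ (x '' {k | t + f (x k) = 0}) := by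
    apply convexHull_min
    · rintro _ ⟨k, rfl⟩
      rcases (h k).lt_or_eq with c | c
      · left; exact c
      · right; exact subset_convexHull ℝ _ ⟨k, c.symm, rfl⟩
    · rw [convex_iff_forall_pos]
      intro y hy z hz a b ha hb hab
      have hy0 : 0 ≤ t + f y := by
        rcases hy with c | c
        · exact le_of_lt c
        · exact (hconv0 y c).ge
      have hz0 : 0 ≤ t + f z := by
        rcases hz with c | c
        · exact le_of_lt c
        · exact (hconv0 z c).ge
      have e : t + f (a • y + b • z) = a * (t + f y) + b * (t + f z) := by
        simp only [map_add, map_smul, smul_eq_mul]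
        have : t = a * t + b * t := by rw [← add_mul, hab, one_mul]
        linarith
      rcases hy with cy | cy
      · left
        simp only [mem_ofPred_eq] at cy ⊢
        rw [e]; positivity
      · rcases hz with cz | cz
        · left
          simp only [mem_ofPred_eq] at cz ⊢
          rw [e]; positivity
        · right
          exact convex_convexHull ℝ _ cy cz ha.le hb.le hab
  apply Subset.antisymm
  · rintro y ⟨hy, hy0⟩
    rcases hsub hy with c | c
    · exact absurd hy0 (ne_of_gt c)
    · exact c
  · intro y hy
    exact ⟨convexHull_mono (image_subset_range _ _) hy, hconv0 y hy⟩

lemma nonneg_on {n : ℕ} (x : Fin (n + 1) → V) (t : ℝ) (f : V →ₗ[ℝ] ℝ)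
    (h : ∀ k, 0 ≤ t + f (x k)) : ∀ y ∈ braxQ x, 0 ≤ t + f y := by
  have : braxQ x ⊆ {y | 0 ≤ t + f y} := by
    apply convexHull_min
    · rintro _ ⟨k, rfl⟩; exact h k
    · intro y hy z hz a b ha hb hab
      simp only [mem_ofPred_eq, map_add, map_smul, smul_eq_mul] at *
      have : t = a * t + b * t := by rw [← add_mul, hab, one_mul]
      nlinarith [mul_nonneg ha hy, mul_nonneg hb hz]
  exact this

lemma face_isFace {n : ℕ} (x : Fin (n + 1) → V) (t : ℝ) (f : V →ₗ[ℝ] ℝ)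
    (h : ∀ k, 0 ≤ t + f (x k)) :
    IsFaceOf (braxQ x) (convexHull ℝ (x '' {k | t + f (x k) = 0})) := by
  refine ⟨⟨convexHull_mono (image_subset_range _ _), ?_⟩, convex_convexHull ℝ _, ?_⟩
  · rw [← face_eq x t f h]
    intro y hy z hz w hw hwo
    obtain ⟨a, b, ha, hb, hab, rfl⟩ := hwo
    have hy0 := nonneg_on x t f h y hy
    have hz0 := nonneg_on x t f h z hz
    have e : t + f (a • y + b • z) = a * (t + f y) + b * (t + f z) := by
      simp only [map_add, map_smul, smul_eq_mul]
      have : t = a * t + b * t := by rw [← add_mul, hab, one_mul]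
      linarith
    have hw0 : t + f (a • y + b • z) = 0 := hw.2
    rw [e] at hw0
    refine ⟨hy, ?_⟩
    have h1 := mul_nonneg ha.le hy0
    have h2 := mul_nonneg hb.le hz0
    have h3 : a * (t + f y) = 0 := by linarith
    exact (mul_eq_zero.1 h3).resolve_left ha.ne'
  · exact ((Set.toFinite _).isCompact_convexHull ℝ).isClosed

lemma isExtreme_self_inter [FiniteDimensional ℝ V] {Q F : Set V} (hF : IsExtreme ℝ Q F)
    (hc : Convex ℝ F) (hne : F.Nonempty) : Q ∩ affineSpan ℝ F ⊆ F := by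
  rintro y ⟨hyQ, hyA⟩
  obtain ⟨z, hz⟩ := hne.intrinsicInterior hc
  have hzF := intrinsicInterior_subset hz
  rw [mem_intrinsicInterior] at hz
  obtain ⟨z', hz', rfl⟩ := hz
  let y' : affineSpan ℝ F := ⟨y, hyA⟩
  have : Nonempty (affineSpan ℝ F) := ⟨z'⟩
  have hcont : Continuous (fun s : ℝ => (AffineMap.lineMap y' z' s : affineSpan ℝ F)) :=
    AffineMap.lineMap_continuous
  have hnhds : ((↑) ⁻¹' F : Set (affineSpan ℝ F)) ∈ nhds (AffineMap.lineMap y' z' (1 : ℝ)) := by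
    rw [AffineMap.lineMap_apply_one]
    exact mem_interior_iff_mem_nhds.1 hz'
  have hev := hcont.continuousAt.preimage_mem_nhds hnhds
  obtain ⟨s, hs1, hs2⟩ : ∃ s : ℝ, 1 < s ∧
      (AffineMap.lineMap y' z' s : affineSpan ℝ F) ∈ ((↑) ⁻¹' F : Set (affineSpan ℝ F)) := by
    have h1 : ∀ᶠ s in nhdsWithin (1 : ℝ) (Ioi 1),
        (AffineMap.lineMap y' z' s : affineSpan ℝ F) ∈ ((↑) ⁻¹' F : Set (affineSpan ℝ F)) :=
      nhdsWithin_le_nhds hev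
    obtain ⟨s, h2, h3⟩ := (h1.and self_mem_nhdsWithin).exists
    exact ⟨s, h3, h2⟩
  have hval : ((AffineMap.lineMap y' z' s : affineSpan ℝ F) : V) = y + s • ((z' : V) - y) := by
    simp [AffineMap.lineMap_apply, y', add_comm]
  rw [mem_preimage, hval] at hs2
  refine hF.2 hyQ (hF.1 hs2) hzF ?_
  have hs0 : 0 < s := by linarith
  refine ⟨1 - s⁻¹, s⁻¹, ?_, by positivity, by ring, ?_⟩
  · have := inv_lt_one_of_one_lt₀ hs1
    linarith
  · rw [smul_add, smul_smul, inv_mul_cancel₀ hs0.ne']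
    module

lemma facet_functional [FiniteDimensional ℝ V] {n d : ℕ} (hd : 3 ≤ d)
    (hV : Module.finrank ℝ V = d) (x : Fin (n + 1) → V) (hQ : sdim (braxQ x) = d)
    {F : Set V} (hF : IsFacetOf d (braxQ x) F) :
    ∃ (t : ℝ) (f : V →ₗ[ℝ] ℝ), (∀ k, 0 ≤ t + f (x k)) ∧ (∃ k, 0 < t + f (x k)) ∧
      F = convexHull ℝ (x '' {k | t + f (x k) = 0}) := by
  obtain ⟨⟨hext, hconv, hcl⟩, hdim⟩ := hF
  have hne : F.Nonempty := by
    by_contra hc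
    rw [sdim, if_neg hc] at hdim
    omega
  rw [sdim, if_pos hne] at hdim
  set D := (affineSpan ℝ F).direction with hD
  obtain ⟨z, hz⟩ := hne
  have hzA : z ∈ affineSpan ℝ F := subset_affineSpan ℝ F hz
  have hlt : D < ⊤ := by
    rw [lt_top_iff_ne_top]
    intro h
    rw [h, finrank_top, hV] at hdim
    omega
  obtain ⟨f, hf0, hf⟩ := Submodule.exists_le_ker_of_lt_top D hlt
  have hker : D = LinearMap.ker f := by
    apply Submodule.eq_of_le_of_finrank_le hf
    have h1 := LinearMap.finrank_range_add_finrank_ker f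
    have h2 : LinearMap.range f = ⊤ := LinearMap.range_eq_top.2 (LinearMap.surjective hf0)
    rw [h2, finrank_top, hV] at h1
    simp only [Module.finrank_self] at h1
    omega
  have hmem : ∀ y, y ∈ affineSpan ℝ F ↔ f y = f z := by
    intro y
    rw [← AffineSubspace.vsub_right_mem_direction_iff_mem hzA, ← hD, hker, LinearMap.mem_ker,
      vsub_eq_sub, map_sub, sub_eq_zero]
  have hFeq : F = braxQ x ∩ {y | f y = f z} := by
    apply Subset.antisymm
    · intro y hy
      exact ⟨hext.1 hy, (hmem y).1 (subset_affineSpan ℝ F hy)⟩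
    · rintro y ⟨h1, h2⟩
      exact isExtreme_self_inter hext hconv ⟨z, hz⟩ ⟨h1, (hmem y).2 h2⟩
  have hside : (∀ k, 0 ≤ f (x k) - f z) ∨ (∀ k, f (x k) - f z ≤ 0) := by
    by_contra hc
    push Not at hc
    obtain ⟨⟨k, hk⟩, ⟨l, hl⟩⟩ := hc
    have hkQ : x k ∈ braxQ x := subset_convexHull ℝ _ ⟨k, rfl⟩
    have hlQ : x l ∈ braxQ x := subset_convexHull ℝ _ ⟨l, rfl⟩
    set α := f z - f (x k) with hα
    set β := f (x l) - f z with hβ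
    have ha : 0 < α := by linarith
    have hb : 0 < β := by linarith
    set w := (β / (α + β)) • x k + (α / (α + β)) • x l with hw
    have hwo : w ∈ openSegment ℝ (x k) (x l) :=
      ⟨β / (α + β), α / (α + β), by positivity, by positivity, by field_simp; ring, rfl⟩
    have hwQ : w ∈ braxQ x :=
      (convex_convexHull ℝ _).openSegment_subset hkQ hlQ hwo
    have hwf : f w = f z := by
      simp only [hw, map_add, map_smul, smul_eq_mul]
      field_simp
      rw [hα, hβ]; ring
    have hwF : w ∈ F := by rw [hFeq]; exact ⟨hwQ, hwf⟩
    have hkF := hext.2 hkQ hlQ hwF hwo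
    rw [hFeq] at hkF
    have : f (x k) = f z := hkF.2
    linarith
  have hnot : ¬ ∀ k, f (x k) = f z := by
    intro hall
    have hFQ : F = braxQ x := by
      rw [hFeq]
      apply inter_eq_left.2
      have := face_eq x (-f z) f (fun k => by rw [hall k]; linarith)
      intro y hy
      have hy2 : y ∈ convexHull ℝ (x '' {k | -f z + f (x k) = 0}) := by
        have e : x '' {k | -f z + f (x k) = 0} = range x := by
          rw [← image_univ]; congr 1; ext k; simp [hall k]
        rw [e]; exact hy
      rw [← this] at hy2
      have := hy2.2
      simp only [mem_ofPred_eq] at this ⊢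
      linarith
    rw [← hFQ, sdim, if_pos ⟨z, hz⟩, ← hD] at hQ
    omega
  push Not at hnot
  obtain ⟨k, hk⟩ := hnot
  rcases hside with hs | hs
  · refine ⟨-f z, f, fun k => by linarith [hs k], ⟨k, ?_⟩, ?_⟩
    · have := lt_of_le_of_ne (hs k) (fun h => hk (by linarith))
      linarith
    · rw [← face_eq x _ _ (fun k => by linarith [hs k]), hFeq]
      congr 1; ext y
      simp only [mem_ofPred_eq]
      constructor <;> intro h <;> linarith
  · refine ⟨f z, -f, fun k => ?_, ⟨k, ?_⟩, ?_⟩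
    · simp only [LinearMap.neg_apply]; linarith [hs k]
    · have := lt_of_le_of_ne (hs k) (fun h => hk (by linarith))
      simp only [LinearMap.neg_apply]; linarith
    · rw [← face_eq x _ _ (fun k => by simp only [LinearMap.neg_apply]; linarith [hs k]), hFeq]
      congr 1; ext y
      simp only [mem_ofPred_eq, LinearMap.neg_apply]
      constructor <;> intro h <;> linarith

lemma facet_maximal [FiniteDimensional ℝ V] {n d : ℕ} (hd : 3 ≤ d) (x : Fin (n + 1) → V)
    {F G : Set V} (hF : IsFacetOf d (braxQ x) F) (hG : IsFacetOf d (braxQ x) G) (hFG : F ⊆ G) :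
    F = G := by
  obtain ⟨⟨hext, hconv, hcl⟩, hdim⟩ := hF
  obtain ⟨⟨hextG, -, -⟩, hdimG⟩ := hG
  have hne : F.Nonempty := by
    by_contra hc
    rw [sdim, if_neg hc] at hdim
    omega
  have hneG := hne.mono hFG
  rw [sdim, if_pos hne] at hdim
  rw [sdim, if_pos hneG] at hdimG
  have hle := affineSpan_mono ℝ hFG
  have hdir := Submodule.eq_of_le_of_finrank_eq (AffineSubspace.direction_le hle) (by omega)
  have hspan : affineSpan ℝ F = affineSpan ℝ G :=
    AffineSubspace.eq_of_direction_eq_of_nonempty_of_le hdir (hne.affineSpan ℝ) hle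
  apply Subset.antisymm hFG
  intro y hy
  refine isExtreme_self_inter hext hconv hne ⟨hextG.1 hy, ?_⟩
  rw [hspan]
  exact subset_affineSpan ℝ G hy

lemma vertex_extreme {n : ℕ} (x : Fin (n + 1) → V) (t : ℝ) (f : V →ₗ[ℝ] ℝ) (i : Fin (n + 1))
    (h0 : t + f (x i) = 0) (h : ∀ k, k ≠ i → 0 < t + f (x k)) :
    x i ∈ Set.extremePoints ℝ (braxQ x) := by
  have hnn : ∀ k, 0 ≤ t + f (x k) := by
    intro k
    by_cases c : k = i
    · rw [c, h0]
    · exact (h k c).le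
  have hs : {k | t + f (x k) = 0} = {i} := by
    ext k
    simp only [mem_ofPred_eq, mem_singleton_iff]
    constructor
    · intro hk
      by_contra c
      exact (h k c).ne' hk
    · rintro rfl; exact h0
  have := (face_isFace x t f hnn).1
  rw [hs, image_singleton, convexHull_singleton, isExtreme_singleton] at this
  exact this

end Geometry

/-- The vertex array: the apex `0` followed by points of the curve. -/
def bx {d : ℕ} (X : ℤ → EuclideanSpace ℝ (Fin d)) (n : ℕ) (i : Fin (n + 1)) :
    EuclideanSpace ℝ (Fin d) := if (i : ℕ) = 0 then 0 else X (i : ℕ)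

section Final

variable {d n : ℕ} {X : ℤ → EuclideanSpace ℝ (Fin d)}

lemma bx_zero : bx X n 0 = 0 := by simp [bx]

lemma bx_pos (i : Fin (n + 1)) (h : (i : ℕ) ≠ 0) : bx X n i = X (i : ℕ) := by simp [bx, h]

lemma xc_mid (k : ℤ) (h1 : 1 ≤ k) (h2 : k ≤ n) : xc (bx X n) k = X k := by
  rw [xc, bx_pos _ (by simp only; omega)]
  congr 1
  simp only; omega

lemma xc_low (k : ℤ) (h1 : k ≤ 0) : xc (bx X n) k = 0 := by
  have : (min (max k 0) (n : ℤ)).toNat = 0 := by omega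
  simp [xc, bx, this]

lemma xc_high (k : ℤ) (hn : 1 ≤ n) (h1 : (n : ℤ) ≤ k) : xc (bx X n) k = X n := by
  rw [xc, bx_pos _ (by simp only; omega)]
  congr 1
  simp only; omega

/-- Points of the array as a predicate on integers. -/
lemma mem_zeros {t : ℝ} {f : EuclideanSpace ℝ (Fin d) →ₗ[ℝ] ℝ} {y : EuclideanSpace ℝ (Fin d)} :
    y ∈ bx X n '' {k | t + f (bx X n k) = 0} ↔
      (y = 0 ∧ t = 0) ∨ ∃ k : ℤ, 1 ≤ k ∧ k ≤ n ∧ t + f (X k) = 0 ∧ y = X k := by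
  constructor
  · rintro ⟨k, hk, rfl⟩
    simp only [mem_ofPred_eq] at hk
    by_cases c : (k : ℕ) = 0
    · left
      have : k = 0 := Fin.ext c
      rw [this, bx_zero] at hk
      rw [this, bx_zero]
      simpa using hk
    · right
      rw [bx_pos k c] at hk ⊢
      exact ⟨(k : ℕ), by omega, by omega, hk, rfl⟩
  · rintro (⟨rfl, ht⟩ | ⟨k, h1, h2, h3, rfl⟩)
    · exact ⟨0, by simp [bx_zero, ht], bx_zero⟩
    · have e : bx X n ⟨k.toNat, by omega⟩ = X k := by
        rw [bx_pos _ (by simp only; omega)]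
        congr 1
        simp only; omega
      exact ⟨⟨k.toNat, by omega⟩, by simp only [mem_ofPred_eq, e]; exact h3, e⟩

lemma bx_nonneg {t : ℝ} (ht : 0 ≤ t) {f : EuclideanSpace ℝ (Fin d) →ₗ[ℝ] ℝ}
    (h : ∀ k : ℤ, 1 ≤ k → k ≤ n → 0 ≤ t + f (X k)) : ∀ k, 0 ≤ t + f (bx X n k) := by
  intro k
  by_cases c : (k : ℕ) = 0
  · have : k = 0 := Fin.ext c
    rw [this, bx_zero]; simpa using ht
  · rw [bx_pos k c]
    exact h _ (by omega) (by omega)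

lemma span_window (hX : ∀ (f : EuclideanSpace ℝ (Fin d) →ₗ[ℝ] ℝ) (i : ℤ),
      (∀ k, i ≤ k → k ≤ i + d - 1 → f (X k) = 0) → f = 0)
    (W : Submodule ℝ (EuclideanSpace ℝ (Fin d))) (s : ℤ)
    (h : ∀ k, s ≤ k → k ≤ s + d - 1 → X k ∈ W) : W = ⊤ := by
  by_contra hc
  obtain ⟨f, hf0, hf⟩ := Submodule.exists_le_ker_of_lt_top W (lt_top_iff_ne_top.2 hc)
  exact hf0 (hX f s (fun k a b => hf (h k a b)))

lemma facet_of_seq (hd : 3 ≤ d)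
    (hX : ∀ (f : EuclideanSpace ℝ (Fin d) →ₗ[ℝ] ℝ) (i : ℤ),
      (∀ k, i ≤ k → k ≤ i + d - 1 → f (X k) = 0) → f = 0)
    {t : ℝ} (ht : 0 ≤ t) {f : EuclideanSpace ℝ (Fin d) →ₗ[ℝ] ℝ}
    (h : ∀ k : ℤ, 1 ≤ k → k ≤ n → 0 ≤ t + f (X k))
    (hpos : 0 < t ∨ ∃ k, 0 < t + f (X k))
    (s : ℤ) (hs1 : 1 ≤ s) (hs2 : s + d - 1 ≤ n)
    (hcase : (t = 0 ∧ ∃ j, ∀ k, s ≤ k → k ≤ s + d - 1 → k ≠ j → t + f (X k) = 0) ∨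
      (∀ k, s ≤ k → k ≤ s + d - 1 → t + f (X k) = 0)) :
    IsFacetOf d (braxQ (bx X n)) (convexHull ℝ (bx X n '' {k | t + f (bx X n k) = 0})) := by
  refine ⟨face_isFace _ t f (bx_nonneg ht h), ?_⟩
  set S := bx X n '' {k | t + f (bx X n k) = 0} with hS
  have hSf : ∀ y ∈ S, t + f y = 0 := by
    rintro _ ⟨k, hk, rfl⟩; exact hk
  have hne : S.Nonempty := by
    rcases hcase with ⟨h0, -⟩ | h1
    · exact ⟨0, mem_zeros.2 (Or.inl ⟨rfl, h0⟩)⟩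
    · exact ⟨X s, mem_zeros.2 (Or.inr ⟨s, hs1, by omega, h1 s le_rfl (by omega), rfl⟩)⟩
  rw [sdim, if_pos hne.convexHull, affineSpan_convexHull, direction_affineSpan]
  have hfne : f ≠ 0 := by
    rintro rfl
    obtain ⟨y, hy⟩ := hne
    have := hSf y hy
    simp only [LinearMap.zero_apply, add_zero] at this hpos
    rcases hpos with c | ⟨_, c⟩ <;> linarith
  have hle : vectorSpan ℝ S ≤ LinearMap.ker f := by
    rw [vectorSpan, Submodule.span_le]
    rintro _ ⟨y, hy, z, hz, rfl⟩
    have h1 := hSf y hy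
    have h2 := hSf z hz
    simp only [SetLike.mem_coe, LinearMap.mem_ker, vsub_eq_sub, map_sub]
    linarith
  have hub : Module.finrank ℝ (vectorSpan ℝ S) + 1 ≤ d := by
    have h1 := LinearMap.finrank_range_add_finrank_ker f
    have h2 : LinearMap.range f = ⊤ := LinearMap.range_eq_top.2 (LinearMap.surjective hfne)
    rw [h2, finrank_top] at h1
    simp only [Module.finrank_self, finrank_euclideanSpace, Fintype.card_fin] at h1
    have h3 := Submodule.finrank_mono hle
    omega
  have hlb : d ≤ Module.finrank ℝ (vectorSpan ℝ S) + 1 := by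
    have key : ∃ v0, vectorSpan ℝ S ⊔ Submodule.span ℝ {v0} = ⊤ := by
      rcases hcase with ⟨h0, j, hj⟩ | h1
      · refine ⟨X j, span_window hX _ s ?_⟩
        intro k a b
        by_cases c : k = j
        · rw [c]
          exact Submodule.mem_sup_right (Submodule.mem_span_singleton_self _)
        · apply Submodule.mem_sup_left
          have hk : X k ∈ S := mem_zeros.2 (Or.inr ⟨k, by omega, by omega, hj k a b c, rfl⟩)
          have h00 : (0 : EuclideanSpace ℝ (Fin d)) ∈ S := mem_zeros.2 (Or.inl ⟨rfl, h0⟩)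
          have := vsub_mem_vectorSpan ℝ hk h00
          simpa using this
      · refine ⟨X s, span_window hX _ s ?_⟩
        intro k a b
        have hk : X k ∈ S := mem_zeros.2 (Or.inr ⟨k, by omega, by omega, h1 k a b, rfl⟩)
        have hs : X s ∈ S :=
          mem_zeros.2 (Or.inr ⟨s, by omega, by omega, h1 s le_rfl (by omega), rfl⟩)
        have := vsub_mem_vectorSpan ℝ hk hs
        have e : X k = (X k -ᵥ X s) + X s := by simp
        rw [e]
        exact Submodule.add_mem_sup this (Submodule.mem_span_singleton_self _)
    obtain ⟨v0, hv0⟩ := key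
    have h1 := Submodule.finrank_add_le_finrank_add_finrank (vectorSpan ℝ S)
      (Submodule.span ℝ {v0})
    rw [hv0, finrank_top, finrank_euclideanSpace, Fintype.card_fin] at h1
    have h2 := finrank_span_le_card (R := ℝ) ({v0} : Set (EuclideanSpace ℝ (Fin d)))
    simp only [toFinset_singleton, Finset.card_singleton] at h2
    omega
  omega

end Final

lemma main_brax (d n : ℕ) (hd : 3 ≤ d) (hn : d ≤ n) :
    ∃ x : Fin (n + 1) → EuclideanSpace ℝ (Fin d), IsBraxtope d n x := by
  obtain ⟨X, hrec, hsol, hX⟩ := exists_curve hd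
  have hV : Module.finrank ℝ (EuclideanSpace ℝ (Fin d)) = d := by simp
  -- vertices
  have hvert : ∀ i : Fin (n + 1), ∃ (t : ℝ) (f : EuclideanSpace ℝ (Fin d) →ₗ[ℝ] ℝ),
      t + f (bx X n i) = 0 ∧ ∀ k, k ≠ i → 0 < t + f (bx X n k) := by
    intro i
    by_cases c : (i : ℕ) = 0
    · have hi : i = 0 := Fin.ext c
      obtain ⟨v, hv, hp⟩ := seqV0 hd
      obtain ⟨f, hf⟩ := hsol 0 v hv
      refine ⟨0, f, by simp [hi, bx_zero], ?_⟩
      intro k hk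
      have hk0 : (k : ℕ) ≠ 0 := fun h => hk (by rw [hi]; exact Fin.ext h)
      rw [bx_pos k hk0, hf]
      exact hp _ (by omega)
    · obtain ⟨v, hv, h0, hp⟩ := seqV hd (i : ℕ)
      obtain ⟨f, hf⟩ := hsol 1 v hv
      refine ⟨1, f, by rw [bx_pos i c, hf, h0], ?_⟩
      intro k hk
      by_cases c' : (k : ℕ) = 0
      · have : k = 0 := Fin.ext c'
        rw [this, bx_zero]; simp
      · rw [bx_pos k c', hf]
        apply hp
        intro h
        exact hk (Fin.ext (by exact_mod_cast h))
  -- facets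
  have hT : ∀ i : ℤ, 0 ≤ i → i ≤ (n : ℤ) - d + 1 →
      IsFacetOf d (braxQ (bx X n)) (convexHull ℝ (Tset d (bx X n) i)) := by
    intro i h0 h1
    by_cases c : i = 0
    · obtain ⟨v, hv, hz, hp⟩ := seqT0 hd
      obtain ⟨f, hf⟩ := hsol 0 v hv
      have e : Tset d (bx X n) i = bx X n '' {k | 0 + f (bx X n k) = 0} := by
        ext y
        rw [mem_zeros]
        constructor
        · rintro ⟨k, ⟨k1, k2⟩, rfl⟩
          by_cases ck : k ≤ 0
          · left; exact ⟨xc_low k ck, rfl⟩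
          · right
            exact ⟨k, by omega, by omega, by rw [hf]; exact hz k (by omega) (by omega),
              xc_mid k (by omega) (by omega)⟩
        · rintro (⟨rfl, -⟩ | ⟨k, k1, k2, k3, rfl⟩)
          · exact ⟨0, ⟨by omega, by omega⟩, xc_low 0 le_rfl⟩
          · refine ⟨k, ⟨by omega, ?_⟩, xc_mid k k1 k2⟩
            by_contra hc
            rw [hf] at k3
            exact (hp k (by omega)).ne' k3
      rw [e]
      have hnn : ∀ k, 1 ≤ k → 0 ≤ v k := by
        intro k a
        by_cases ck : k ≤ d - 1
        · exact (hz k a ck).ge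
        · exact (hp k (by omega)).le
      refine facet_of_seq hd hX le_rfl (fun k a b => by rw [hf]; exact hnn k a)
        (Or.inr ⟨d, by rw [hf]; exact hp d le_rfl⟩) 1 le_rfl (by omega)
        (Or.inl ⟨rfl, d, fun k a b c => ?_⟩)
      rw [hf]; exact hz k (by omega) (by omega)
    · obtain ⟨v, hv, hz, hp⟩ := seqT hd i
      obtain ⟨f, hf⟩ := hsol 1 v hv
      have e : Tset d (bx X n) i = bx X n '' {k | 1 + f (bx X n k) = 0} := by
        ext y
        rw [mem_zeros]
        constructor
        · rintro ⟨k, ⟨k1, k2⟩, rfl⟩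
          right
          exact ⟨k, by omega, by omega, by rw [hf]; exact hz k (by omega) (by omega),
              xc_mid k (by omega) (by omega)⟩
        · rintro (⟨rfl, h⟩ | ⟨k, k1, k2, k3, rfl⟩)
          · norm_num at h
          · refine ⟨k, ?_, xc_mid k k1 k2⟩
            by_contra hc
            rw [mem_Icc] at hc
            rw [hf] at k3
            exact (hp k (by omega)).ne' k3
      rw [e]
      have hnn : ∀ k, 0 ≤ v k := by
        intro k
        by_cases ck : i ≤ k ∧ k ≤ i + d - 1
        · exact (hz k ck.1 ck.2).ge
        · exact (hp k (by omega)).le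
      refine facet_of_seq hd hX zero_le_one (fun k a b => by rw [hf]; exact hnn k)
        (Or.inl one_pos) i (by omega) (by omega) (Or.inr fun k a b => ?_)
      rw [hf]; exact hz k (by omega) (by omega)
  have hE : ∀ j : ℤ, 2 ≤ j → j ≤ (n : ℤ) →
      IsFacetOf d (braxQ (bx X n)) (convexHull ℝ (Eset d (bx X n) j)) := by
    intro j h0 h1
    by_cases c : j = n
    · obtain ⟨v, hv, hz, hp⟩ := seqEn hd n
      obtain ⟨f, hf⟩ := hsol 0 v hv
      have e : Eset d (bx X n) j = bx X n '' {k | 0 + f (bx X n k) = 0} := by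
        ext y
        rw [mem_zeros, Eset, bx_zero, mem_insert_iff]
        constructor
        · rintro (rfl | ⟨k, ⟨⟨k1, k2⟩, k3⟩, rfl⟩)
          · left; exact ⟨rfl, rfl⟩
          · rw [mem_singleton_iff] at k3
            by_cases ck : k ≤ 0
            · left; exact ⟨xc_low k ck, rfl⟩
            · right
              by_cases ck' : k ≤ n
              · exact ⟨k, by omega, by omega, by rw [hf]; exact hz k (by omega) (by omega),
                  xc_mid k (by omega) (by omega)⟩
              · exact ⟨n, by omega, by omega, by rw [hf]; exact hz n (by omega) (by omega),
                  xc_high k (by omega) (by omega)⟩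
        · rintro (⟨rfl, -⟩ | ⟨k, k1, k2, k3, rfl⟩)
          · left; rfl
          · right
            have hk : (n : ℤ) - d + 2 ≤ k := by
              by_contra hc
              rw [hf] at k3
              exact (hp k (by omega)).ne' k3
            by_cases ck : k = n
            · refine ⟨n + 1, ⟨⟨by omega, by omega⟩, ?_⟩, ?_⟩
              · rw [mem_singleton_iff]; omega
              · rw [ck]; exact xc_high _ (by omega) (by omega)
            · refine ⟨k, ⟨⟨by omega, by omega⟩, ?_⟩, xc_mid k k1 k2⟩
              rw [mem_singleton_iff]; omega
      rw [e]
      have hnn : ∀ k, k ≤ (n : ℤ) → 0 ≤ v k := by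
        intro k a
        by_cases ck : k ≤ n - d + 1
        · exact (hp k ck).le
        · exact (hz k (by omega) a).ge
      refine facet_of_seq hd hX le_rfl (fun k a b => by rw [hf]; exact hnn k b)
        (Or.inr ⟨n - d + 1, by rw [hf]; exact hp _ le_rfl⟩) (n - d + 1) (by omega) (by omega)
        (Or.inl ⟨rfl, n - d + 1, fun k a b c => ?_⟩)
      rw [hf]; exact hz k (by omega) (by omega)
    · obtain ⟨v, hv, hz, hp⟩ := seqE hd j
      obtain ⟨f, hf⟩ := hsol 0 v hv
      have e : Eset d (bx X n) j = bx X n '' {k | 0 + f (bx X n k) = 0} := by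
        ext y
        rw [mem_zeros, Eset, bx_zero, mem_insert_iff]
        constructor
        · rintro (rfl | ⟨k, ⟨⟨k1, k2⟩, k3⟩, rfl⟩)
          · left; exact ⟨rfl, rfl⟩
          · rw [mem_singleton_iff] at k3
            by_cases ck : k ≤ 0
            · left; exact ⟨xc_low k ck, rfl⟩
            · right
              by_cases ck' : k ≤ n
              · exact ⟨k, by omega, by omega,
                  by rw [hf]; exact hz k (by omega) (by omega) k3,
                  xc_mid k (by omega) (by omega)⟩
              · exact ⟨n, by omega, by omega,
                  by rw [hf]; exact hz n (by omega) (by omega) (by omega),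
                  xc_high k (by omega) (by omega)⟩
        · rintro (⟨rfl, -⟩ | ⟨k, k1, k2, k3, rfl⟩)
          · left; rfl
          · right
            have hk : ¬ (k < j - d + 2 ∨ j + d - 2 < k ∨ k = j) := by
              intro hc
              rw [hf] at k3
              exact (hp k hc).ne' k3
            refine ⟨k, ⟨⟨by omega, by omega⟩, ?_⟩, xc_mid k k1 k2⟩
            rw [mem_singleton_iff]; omega
      rw [e]
      have hnn : ∀ k, 0 ≤ v k := by
        intro k
        by_cases ck : k < j - d + 2 ∨ j + d - 2 < k ∨ k = j
        · exact (hp k ck).le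
        · exact (hz k (by omega) (by omega) (by omega)).ge
      refine facet_of_seq hd hX le_rfl (fun k a b => by rw [hf]; exact hnn k)
        (Or.inr ⟨j, by rw [hf]; exact hp _ (by omega)⟩) (max 1 (j - d + 2)) (by omega) (by omega)
        (Or.inl ⟨rfl, j, fun k a b c => ?_⟩)
      rw [hf]; exact hz k (by omega) (by omega) c
  have hQ : sdim (braxQ (bx X n)) = d := by
    have hne : (range (bx X n)).Nonempty := range_nonempty _
    rw [braxQ, sdim, if_pos hne.convexHull, affineSpan_convexHull, direction_affineSpan]
    have : vectorSpan ℝ (range (bx X n)) = ⊤ := by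
      apply span_window hX _ 1
      intro k a b
      have h1 : X k ∈ range (bx X n) := by
        rw [← xc_mid (n := n) (X := X) k (by omega) (by omega)]; exact ⟨_, rfl⟩
      have h2 : (0 : EuclideanSpace ℝ (Fin d)) ∈ range (bx X n) := ⟨0, bx_zero⟩
      simpa using vsub_mem_vectorSpan ℝ h1 h2
    rw [this, finrank_top, hV]
  refine ⟨bx X n, fun h => by omega, fun _ => ⟨hn, ?_, hQ, ?_, ?_⟩⟩
  · intro i k hik
    obtain ⟨t, f, h0, hp⟩ := hvert i
    by_contra hne
    have := hp k (fun h => hne h.symm)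
    rw [← hik] at this
    exact this.ne' h0
  · intro i
    obtain ⟨t, f, h0, hp⟩ := hvert i
    exact vertex_extreme _ t f i h0 hp
  · intro F
    constructor
    · intro hF
      obtain ⟨t, f, hnn, ⟨k0, hk0⟩, hFe⟩ := facet_functional hd hV _ hQ hF
      have ht : 0 ≤ t := by simpa [bx_zero] using hnn 0
      have hnn' : ∀ k : ℤ, 1 ≤ k → k ≤ (n : ℤ) → 0 ≤ t + f (X k) := by
        intro k a b
        have := hnn ⟨k.toNat, by omega⟩
        rw [bx_pos _ (by simp only; omega)] at this
        have e : (((k.toNat : ℕ) : ℤ)) = k := by omega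
        simpa only [e] using this
      have hr := hrec t f
      rcases ht.lt_or_eq with ht' | ht'
      · left
        obtain ⟨i, i1, i2, i3⟩ := zerosT hd hn ht' hr hnn'
        refine ⟨i, by omega, i2, ?_⟩
        refine facet_maximal hd _ hF (hT i (by omega) i2) ?_
        rw [hFe]
        apply convexHull_mono
        intro y hy
        rcases mem_zeros.1 hy with ⟨-, h⟩ | ⟨k, k1, k2, k3, rfl⟩
        · exact absurd h ht'.ne'
        · exact ⟨k, i3 k k1 k2 k3, xc_mid k k1 k2⟩
      · subst ht'
        have hnz : ∃ k, 0 + f (X k) ≠ 0 := by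
          by_cases c : (k0 : ℕ) = 0
          · have : k0 = 0 := Fin.ext c
            rw [this, bx_zero] at hk0
            simp at hk0
          · rw [bx_pos k0 c] at hk0
            exact ⟨_, hk0.ne'⟩
        rcases zerosE hd hn hr hnn' hnz with h | h | ⟨j, j1, j2, j3⟩
        · left
          refine ⟨0, le_rfl, by omega, ?_⟩
          refine facet_maximal hd _ hF (hT 0 le_rfl (by omega)) ?_
          rw [hFe]
          apply convexHull_mono
          intro y hy
          rcases mem_zeros.1 hy with ⟨rfl, -⟩ | ⟨k, k1, k2, k3, rfl⟩
          · exact ⟨0, ⟨le_rfl, by omega⟩, xc_low 0 le_rfl⟩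
          · have := h k k1 k2 k3
            exact ⟨k, ⟨by omega, by omega⟩, xc_mid k k1 k2⟩
        · right
          refine ⟨n, by omega, le_rfl, ?_⟩
          refine facet_maximal hd _ hF (hE n (by omega) le_rfl) ?_
          rw [hFe]
          apply convexHull_mono
          intro y hy
          rw [Eset, bx_zero, mem_insert_iff]
          rcases mem_zeros.1 hy with ⟨rfl, -⟩ | ⟨k, k1, k2, k3, rfl⟩
          · left; rfl
          · right
            have := h k k1 k2 k3
            by_cases ck : k = n
            · refine ⟨n + 1, ⟨⟨by omega, by omega⟩, ?_⟩, ?_⟩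
              · rw [mem_singleton_iff]; omega
              · rw [ck]; exact xc_high _ (by omega) (by omega)
            · refine ⟨k, ⟨⟨by omega, by omega⟩, ?_⟩, xc_mid k k1 k2⟩
              rw [mem_singleton_iff]; omega
        · right
          refine ⟨j, j1, by omega, ?_⟩
          refine facet_maximal hd _ hF (hE j j1 (by omega)) ?_
          rw [hFe]
          apply convexHull_mono
          intro y hy
          rw [Eset, bx_zero, mem_insert_iff]
          rcases mem_zeros.1 hy with ⟨rfl, -⟩ | ⟨k, k1, k2, k3, rfl⟩
          · left; rfl
          · right
            have := j3 k k1 k2 k3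
            refine ⟨k, ⟨⟨by omega, by omega⟩, ?_⟩, xc_mid k k1 k2⟩
            rw [mem_singleton_iff]; omega
    · rintro (⟨i, i1, i2, rfl⟩ | ⟨j, j1, j2, rfl⟩)
      · exact hT i i1 i2
      · exact hE j j1 j2

/-- For every `n ≥ d ≥ 3` there is a `d`-braxtope `Q^{d,n}` realized in `ℝ^d`. -/
theorem braxtope_realizable (d n : ℕ) (hd : 3 ≤ d) (hn : d ≤ n) :
    ∃ x : Fin (n + 1) → EuclideanSpace ℝ (Fin d), IsBraxtope d n x := by
  exact main_brax d n hd hn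
end
end

section
/- Let Q = Q^{d,n} be a d-braxtope with vertex array x_0 < x_1 < ... < x_n, n ≥ d+1 ≥ 4. Then Q' = conv{x_0, x_1, ..., x_{n-1}} is a d-braxtope with vertex array x_0 < x_1 < ... < x_{n-1}. -/
open Set

noncomputable section

variable {V : Type*} [NormedAddCommGroup V] [NormedSpace ℝ V]

/-- Every vector of the vector span of a convex set is a nonnegative multiple of a difference. -/
lemma bx_vectorSpan_convex {F : Set V} (hF : Convex ℝ F) (hne : F.Nonempty) {v : V}
    (hv : v ∈ vectorSpan ℝ F) : ∃ t : ℝ, 0 ≤ t ∧ ∃ a ∈ F, ∃ b ∈ F, v = t • (a - b) := by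
  obtain ⟨p, hp⟩ := hne
  rw [vectorSpan] at hv
  induction hv using Submodule.span_induction with
  | mem u hu =>
    obtain ⟨a, ha, b, hb, rfl⟩ := hu
    exact ⟨1, by norm_num, a, ha, b, hb, by simp⟩
  | zero => exact ⟨0, le_rfl, p, hp, p, hp, by simp⟩
  | add u w _ _ hu hw =>
    obtain ⟨t, ht, a, ha, b, hb, rfl⟩ := hu
    obtain ⟨s, hs, a', ha', b', hb', rfl⟩ := hw
    rcases eq_or_lt_of_le (add_nonneg ht hs) with h | h
    · have h1 : t = 0 := by linarith
      have h2 : s = 0 := by linarith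
      exact ⟨0, le_rfl, p, hp, p, hp, by simp [h1, h2]⟩
    · refine ⟨t + s, h.le, (t / (t + s)) • a + (s / (t + s)) • a',
        hF ha ha' (by positivity) (by positivity) (by field_simp),
        (t / (t + s)) • b + (s / (t + s)) • b',
        hF hb hb' (by positivity) (by positivity) (by field_simp), ?_⟩
      have h3 : (t + s) * (t / (t + s)) = t := by field_simp
      have h4 : (t + s) * (s / (t + s)) = s := by field_simp
      rw [smul_sub (t + s), smul_add, smul_add, smul_smul, smul_smul, smul_smul, smul_smul, h3, h4]
      module
  | smul r u _ hu =>
    obtain ⟨t, ht, a, ha, b, hb, rfl⟩ := hu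
    rcases le_total 0 r with h | h
    · exact ⟨r * t, by positivity, a, ha, b, hb, by rw [smul_smul]⟩
    · exact ⟨(-r) * t, mul_nonneg (by linarith) ht, b, hb, a, ha, by module⟩

/-- A convex extreme subset contains all points of `Q` in its affine hull. -/
lemma bx_mem_of_sub_mem {Q F : Set V} (hF : IsExtreme ℝ Q F) (hc : Convex ℝ F) {p q : V}
    (hp : p ∈ F) (hq : q ∈ Q) (h : q - p ∈ vectorSpan ℝ F) : q ∈ F := by
  obtain ⟨t, ht, a, ha, b, hb, hv⟩ := bx_vectorSpan_convex hc ⟨p, hp⟩ h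
  rcases eq_or_lt_of_le ht with h0 | h0
  · rw [← h0, zero_smul, sub_eq_zero] at hv
    rwa [hv]
  · have hm : (1 / (1 + t)) • p + (t / (1 + t)) • a ∈ F :=
      hc hp ha (by positivity) (by positivity) (by field_simp)
    refine hF.left_mem_of_mem_openSegment hq (hF.subset hb) hm ?_
    refine ⟨1 / (1 + t), t / (1 + t), by positivity, by positivity, by field_simp, ?_⟩
    have : q = p + t • (a - b) := by rw [← hv]; abel
    rw [this]
    have e : t / (1 + t) = (1 / (1 + t)) * t := by ring
    rw [e]
    module

/-- A convex extreme subset of a convex hull is the hull of the generators it contains. -/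
lemma bx_face_eq {S F : Set V} (hF : IsExtreme ℝ (convexHull ℝ S) F) (hc : Convex ℝ F) :
    F = convexHull ℝ (S ∩ F) := by
  apply Subset.antisymm
  · have key : convexHull ℝ S ⊆ {q | q ∈ convexHull ℝ S ∧ (q ∈ F → q ∈ convexHull ℝ (S ∩ F))} := by
      apply convexHull_min
      · intro s hs
        exact ⟨subset_convexHull ℝ S hs, fun h => subset_convexHull ℝ _ ⟨hs, h⟩⟩
      · rw [convex_iff_openSegment_subset]
        rintro a ⟨ha, ha'⟩ b ⟨hb, hb'⟩ q hq
        have hqS : q ∈ convexHull ℝ S :=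
          (convex_convexHull ℝ S).openSegment_subset ha hb hq
        refine ⟨hqS, fun hqF => ?_⟩
        have h1 := hF.left_mem_of_mem_openSegment ha hb hqF hq
        have h2 := hF.right_mem_of_mem_openSegment ha hb hqF hq
        exact (convex_convexHull ℝ _).openSegment_subset (ha' h1) (hb' h2) hq
    intro q hq
    exact (key (hF.subset hq)).2 hq
  · exact convexHull_min inter_subset_right hc

/-- The minimum locus of a linear functional is extreme. -/
lemma bx_exposed {Q : Set V} (L : V →ₗ[ℝ] ℝ) (c : ℝ) (h : ∀ q ∈ Q, c ≤ L q) :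
    IsExtreme ℝ Q {q | q ∈ Q ∧ L q = c} := by
  refine ⟨fun q hq => hq.1, ?_⟩
  rintro u hu v hv z ⟨hz, hzc⟩ ⟨α, β, hα, hβ, hαβ, rfl⟩
  refine ⟨hu, ?_⟩
  have h1 := h u hu
  have h2 := h v hv
  simp only [map_add, map_smul, smul_eq_mul] at hzc
  have h3 : α * (L u - c) + β * (L v - c) = 0 := by linear_combination hzc - c * hαβ
  have h4 : 0 ≤ β * (L v - c) := mul_nonneg hβ.le (by linarith)
  have h5 : 0 ≤ L u - c := by linarith
  have h6 : α * (L u - c) ≤ 0 := by linarith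
  nlinarith

lemma bx_exposed_convex {Q : Set V} (hQ : Convex ℝ Q) (L : V →ₗ[ℝ] ℝ) (c : ℝ) :
    Convex ℝ {q | q ∈ Q ∧ L q = c} :=
  hQ.inter (convex_hyperplane L.isLinear c)

/-- Supporting functional of a facet. -/
lemma bx_support {Q F : Set V} {d : ℕ} (hQ : Convex ℝ Q) (hF : IsExtreme ℝ Q F)
    (hc : Convex ℝ F) (hne : F.Nonempty)
    (hdQ : Module.finrank ℝ (vectorSpan ℝ Q) = d)
    (hdF : Module.finrank ℝ (vectorSpan ℝ F) + 1 = d) :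
    ∃ (f : V →ₗ[ℝ] ℝ) (c : ℝ), (∀ q ∈ Q, c ≤ f q) ∧ (∀ q ∈ Q, f q = c ↔ q ∈ F) := by
  obtain ⟨p, hp⟩ := hne
  have hfd : FiniteDimensional ℝ (vectorSpan ℝ Q) := by
    apply FiniteDimensional.of_finrank_pos; omega
  have hle : vectorSpan ℝ F ≤ vectorSpan ℝ Q := vectorSpan_mono ℝ hF.subset
  have hlt : ¬ vectorSpan ℝ Q ≤ vectorSpan ℝ F := by
    intro h
    have := le_antisymm h hle
    rw [this] at hdQ
    omega
  obtain ⟨v, hvQ, hvF⟩ := SetLike.not_le_iff_exists.1 hlt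
  obtain ⟨f, hfv, hfF⟩ := Submodule.exists_le_ker_of_notMem hvF
  have hker : ∀ w ∈ vectorSpan ℝ Q, f w = 0 → w ∈ vectorSpan ℝ F := by
    have hlt2 : vectorSpan ℝ Q ⊓ f.ker < vectorSpan ℝ Q := by
      refine lt_of_le_of_ne inf_le_left fun h => ?_
      have : v ∈ vectorSpan ℝ Q ⊓ f.ker := by rw [h]; exact hvQ
      exact hfv this.2
    have h2 := Submodule.finrank_lt_finrank_of_lt hlt2
    have : FiniteDimensional ℝ ↥(vectorSpan ℝ Q ⊓ f.ker) :=
      Submodule.finiteDimensional_of_le (inf_le_left : _ ≤ vectorSpan ℝ Q)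
    have h3 : vectorSpan ℝ F = vectorSpan ℝ Q ⊓ f.ker :=
      Submodule.eq_of_le_of_finrank_le (le_inf hle hfF) (by omega)
    intro w hw hw0
    rw [h3]
    exact ⟨hw, hw0⟩
  have hiff : ∀ q ∈ Q, f q = f p ↔ q ∈ F := by
    intro q hq
    constructor
    · intro h
      refine bx_mem_of_sub_mem hF hc hp hq (hker _ ?_ (by simp [h]))
      exact vsub_mem_vectorSpan ℝ hq (hF.subset hp)
    · intro h
      have := hfF (vsub_mem_vectorSpan ℝ h hp)
      simpa [sub_eq_zero] using this
  have hsign : (∀ q ∈ Q, f p ≤ f q) ∨ (∀ q ∈ Q, f q ≤ f p) := by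
    by_contra hcon
    push Not at hcon
    obtain ⟨⟨u, hu, hu'⟩, ⟨w, hw, hw'⟩⟩ := hcon
    have hpos : 0 < f w - f u := by linarith
    set s := (f w - f p) / (f w - f u) with hs
    set t := (f p - f u) / (f w - f u) with ht
    have hs0 : 0 < s := div_pos (by linarith) hpos
    have ht0 : 0 < t := div_pos (by linarith) hpos
    have hst : s + t = 1 := by rw [hs, ht]; field_simp; ring
    have hm : s • u + t • w ∈ F := by
      refine (hiff _ (hQ hu hw hs0.le ht0.le hst)).1 ?_
      simp only [map_add, map_smul, smul_eq_mul]
      rw [hs, ht]; field_simp; ring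
    have := hF.left_mem_of_mem_openSegment hu hw hm ⟨s, t, hs0, ht0, hst, rfl⟩
    have := (hiff u hu).2 this
    linarith
  rcases hsign with h | h
  · exact ⟨f, f p, h, hiff⟩
  · refine ⟨-f, -f p, fun q hq => by simpa using h q hq, fun q hq => ?_⟩
    rw [← hiff q hq]; simp

lemma bx_sdim {s : Set V} {k : ℕ} :
    sdim s = (k : ℤ) ↔ s.Nonempty ∧ Module.finrank ℝ (vectorSpan ℝ s) = k := by
  unfold sdim
  split_ifs with h
  · rw [direction_affineSpan]; simp [h]
  · constructor
    · intro h1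
      exact h1.elim
    · intro h1; exact absurd h1.1 h

lemma bx_facet_iff {d : ℕ} (hd : 1 ≤ d) {Q F : Set V} :
    IsFacetOf d Q F ↔ IsExtreme ℝ Q F ∧ Convex ℝ F ∧ IsClosed F ∧ F.Nonempty ∧
      Module.finrank ℝ (vectorSpan ℝ F) + 1 = d := by
  have h : ((d : ℤ) - 1) = ((d - 1 : ℕ) : ℤ) := by omega
  unfold IsFacetOf IsFaceOf
  rw [h, bx_sdim]
  constructor
  · rintro ⟨⟨a, b, c⟩, e, f⟩
    exact ⟨a, b, c, e, by omega⟩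
  · rintro ⟨a, b, c, e, f⟩
    exact ⟨⟨a, b, c⟩, e, by omega⟩

lemma bx_coords {d : ℕ} {D : Submodule ℝ V} (hd : 1 ≤ d) (hD : Module.finrank ℝ D = d)
    (e : Fin d → V) (he : ∀ k, e k ∈ D) (c : Fin d → V →ₗ[ℝ] ℝ)
    (hc : ∀ l k, c l (e k) = if l = k then 1 else 0) {w : V} (hw : w ∈ D) :
    w = ∑ k, c k w • e k := by
  have hfd : FiniteDimensional ℝ D := by
    apply FiniteDimensional.of_finrank_pos; omega
  have hli : LinearIndependent ℝ (fun k => (⟨e k, he k⟩ : D)) := by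
    rw [Fintype.linearIndependent_iff]
    intro g hg l
    have h1 : ∑ k, g k • e k = 0 := by
      have := congrArg (Subtype.val) hg
      simpa using this
    have h2 := congrArg (c l) h1
    simpa [hc] using h2
  have hsp := hli.span_eq_top_of_card_eq_finrank' (by simp [hD])
  have : (⟨w, hw⟩ : D) ∈ Submodule.span ℝ (Set.range fun k => (⟨e k, he k⟩ : D)) := by
    rw [hsp]; trivial
  obtain ⟨g, hg⟩ := (Submodule.mem_span_range_iff_exists_fun ℝ).1 this
  have h1 : ∑ k, g k • e k = w := by
    have := congrArg (Subtype.val) hg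
    simpa using this
  have h2 : ∀ l, c l w = g l := by
    intro l
    rw [← h1]
    simp [hc]
  simp only [h2, h1]

lemma bx_vs_hull (s : Set V) : vectorSpan ℝ (convexHull ℝ s) = vectorSpan ℝ s := by
  rw [← direction_affineSpan, affineSpan_convexHull, direction_affineSpan]

lemma bx_restrict {Q Q' G : Set V} (hG : IsExtreme ℝ Q G) (h : Q' ⊆ Q) :
    IsExtreme ℝ Q' (Q' ∩ G) := by
  refine ⟨inter_subset_left, ?_⟩
  intro u hu v hv w hw hwo
  exact ⟨hu, hG.left_mem_of_mem_openSegment (h hu) (h hv) hw.2 hwo⟩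

/-- The combinatorics of removing a simple vertex `a` with neighbours `y k`. -/
theorem bx_abstract {d : ℕ} (hd : 2 ≤ d) {S : Set V} (hS : S.Finite)
    (hdim : Module.finrank ℝ (vectorSpan ℝ (convexHull ℝ S)) = d)
    (hext : ∀ s ∈ S, s ∈ Set.extremePoints ℝ (convexHull ℝ S)) {a : V} (ha : a ∈ S)
    (y : Fin d → V) (hy : ∀ k, y k ∈ S) (hya : ∀ k, y k ≠ a) (Φ : Fin d → Set V)
    (hΦ : ∀ k, IsFacetOf d (convexHull ℝ S) (Φ k)) (haΦ : ∀ k, a ∈ Φ k)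
    (hyΦ : ∀ k l, k ≠ l → y l ∈ Φ k) (hyn : ∀ k, y k ∉ Φ k)
    {z : V} (hz : z ∈ S) (hza : z ≠ a) (hzy : z ∉ Set.range y) :
    Module.finrank ℝ (vectorSpan ℝ (convexHull ℝ (S \ {a}))) = d ∧
    ∀ F : Set V, IsFacetOf d (convexHull ℝ (S \ {a})) F ↔
      F = convexHull ℝ (Set.range y) ∨
      ∃ G, IsFacetOf d (convexHull ℝ S) G ∧
        (a ∉ G ∨ ∃ z ∈ S, z ∈ G ∧ z ≠ a ∧ z ∉ Set.range y) ∧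
        F = convexHull ℝ ((S \ {a}) ∩ G) := by
  have hd1 : 1 ≤ d := by omega
  set Q := convexHull ℝ S with hQdef
  set Q' := convexHull ℝ (S \ {a}) with hQ'def
  have hQc : Convex ℝ Q := convex_convexHull ℝ S
  have hQ'c : Convex ℝ Q' := convex_convexHull ℝ _
  have hSQ : S ⊆ Q := subset_convexHull ℝ S
  have hSQ' : S \ {a} ⊆ Q' := subset_convexHull ℝ _
  have hQ'Q : Q' ⊆ Q := convexHull_mono sdiff_subset
  have hyS' : ∀ k, y k ∈ S \ {a} := fun k => ⟨hy k, hya k⟩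
  have hfd : FiniteDimensional ℝ (vectorSpan ℝ Q) := by
    apply FiniteDimensional.of_finrank_pos; omega
  -- coordinate functionals
  have hex : ∀ k, ∃ f : V →ₗ[ℝ] ℝ, (∀ q ∈ Q, 0 ≤ f (q - a)) ∧
      ∀ l, f (y l - a) = if k = l then 1 else 0 := by
    intro k
    obtain ⟨h1, h2, h3, h4, h5⟩ := (bx_facet_iff hd1).1 (hΦ k)
    obtain ⟨f, c, hf, hfi⟩ := bx_support hQc h1 h2 h4 hdim h5
    have hfa : f a = c := (hfi a (hSQ ha)).2 (haΦ k)
    have hpos : 0 < f (y k) - c := by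
      have h6 := hf _ (hSQ (hy k))
      have h7 : f (y k) ≠ c := fun h => hyn k ((hfi _ (hSQ (hy k))).1 h)
      exact sub_pos.2 (lt_of_le_of_ne h6 (Ne.symm h7))
    refine ⟨(f (y k) - c)⁻¹ • f, ?_, ?_⟩
    · intro q hq
      have := hf q hq
      rw [LinearMap.smul_apply, map_sub, smul_eq_mul, hfa]
      exact mul_nonneg (inv_nonneg.2 hpos.le) (by linarith)
    · intro l
      rw [LinearMap.smul_apply, map_sub, smul_eq_mul, hfa]
      split_ifs with h
      · subst h; exact inv_mul_cancel₀ hpos.ne'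
      · rw [(hfi _ (hSQ (hy l))).2 (hyΦ k l h)]; simp
  choose c hc0 hcy using hex
  have hvs : ∀ q ∈ Q, q - a ∈ vectorSpan ℝ Q := fun q hq => vsub_mem_vectorSpan ℝ hq (hSQ ha)
  have hcoord : ∀ w ∈ vectorSpan ℝ Q, w = ∑ k, c k w • (y k - a) := fun w hw =>
    bx_coords hd1 hdim (fun k => y k - a) (fun k => hvs _ (hSQ (hy k))) c hcy hw
  set L : V →ₗ[ℝ] ℝ := ∑ k, c k with hL
  have hLapp : ∀ v, L v = ∑ k, c k v := fun v => by simp [hL]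
  have hLy : ∀ k, L (y k) = 1 + L a := by
    intro k
    have : L (y k - a) = 1 := by rw [hLapp]; simp [hcy]
    rw [map_sub] at this; linarith
  -- other vertices are beyond the hyperplane
  have hbeyond : ∀ s ∈ S, s ≠ a → s ∉ Set.range y → 1 < L (s - a) := by
    intro s hs hsa hsy
    by_contra hcon
    push Not at hcon
    have hmem : s ∈ convexHull ℝ (insert a (Set.range y)) := by
      have h1 := (convex_convexHull ℝ (insert a (Set.range y))).sum_mem
        (t := (Finset.univ : Finset (Option (Fin d))))
        (w := fun o => o.elim (1 - L (s - a)) (fun k => c k (s - a)))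
        (z := fun o => o.elim a y) ?_ ?_ ?_
      · rw [Fintype.sum_option] at h1
        simp only [Option.elim] at h1
        convert h1 using 1
        have h2 := hcoord _ (hvs s (hSQ hs))
        simp only [smul_sub, Finset.sum_sub_distrib, ← Finset.sum_smul, ← hLapp] at h2
        rw [sub_smul, one_smul, eq_comm, ← sub_eq_zero]
        rw [← sub_eq_zero] at h2
        rw [← neg_eq_zero, ← h2]
        abel
      · rintro (_ | k) _
        · simpa using hcon
        · exact hc0 k s (hSQ hs)
      · rw [Fintype.sum_option]
        simp only [Option.elim, ← hLapp]; ring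
      · rintro (_ | k) _
        · exact subset_convexHull ℝ _ (by simp)
        · exact subset_convexHull ℝ _ (by simp)
    have hsub : convexHull ℝ (insert a (Set.range y)) ⊆ Q := by
      apply convexHull_mono
      rintro u (rfl | ⟨k, rfl⟩)
      · exact ha
      · exact hy k
    have h3 := extremePoints_convexHull_subset
      (inter_extremePoints_subset_extremePoints_of_subset hsub ⟨hmem, hext s hs⟩)
    rcases h3 with h | h
    · exact hsa h
    · exact hsy h
  have hLQ' : ∀ q ∈ Q', 1 + L a ≤ L q := by
    have : Q' ⊆ {q | 1 + L a ≤ L q} := by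
      apply convexHull_min
      · rintro s ⟨hs, hsa⟩
        by_cases hsy : s ∈ Set.range y
        · obtain ⟨k, rfl⟩ := hsy
          exact (hLy k).ge
        · have := hbeyond s hs hsa hsy
          rw [map_sub] at this
          simp only [mem_ofPred_eq]; linarith
      · exact convex_halfSpace_ge L.isLinear _
    exact this
  have hYext := bx_exposed L (1 + L a) hLQ'
  have hYeq : {q | q ∈ Q' ∧ L q = 1 + L a} = convexHull ℝ (Set.range y) := by
    rw [bx_face_eq hYext (bx_exposed_convex hQ'c L _)]
    congr 1
    ext s
    constructor
    · rintro ⟨⟨hs, hsa⟩, _, hsL⟩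
      by_contra hsy
      have := hbeyond s hs hsa hsy
      rw [map_sub] at this
      linarith
    · rintro ⟨k, rfl⟩
      exact ⟨hyS' k, hSQ' (hyS' k), hLy k⟩
  -- the apex in affine subspaces
  have hapex : ∀ (A : AffineSubspace ℝ V) (s : V), s ∈ S → s ≠ a → s ∉ Set.range y → s ∈ A →
      (∀ k, c k (s - a) ≠ 0 → y k ∈ A) → a ∈ A := by
    intro A s hs hsa hsy hsA hk
    have hb := hbeyond s hs hsa hsy
    have h1 : (1 - L (s - a)) • (s - a) = ∑ k, c k (s - a) • (y k - s) := by
      have h2 := hcoord _ (hvs s (hSQ hs))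
      have h3 : ∑ k, c k (s - a) • (y k - s) =
          ∑ k, c k (s - a) • (y k - a) - L (s - a) • (s - a) := by
        rw [hLapp, Finset.sum_smul, ← Finset.sum_sub_distrib]
        refine Finset.sum_congr rfl fun k _ => ?_
        rw [← smul_sub]; congr 1; abel
      rw [h3, ← h2]; module
    have h4 : (1 - L (s - a)) • (s - a) ∈ A.direction := by
      rw [h1]
      refine Submodule.sum_mem _ fun k _ => ?_
      by_cases h0 : c k (s - a) = 0
      · rw [h0, zero_smul]; exact Submodule.zero_mem _
      · exact Submodule.smul_mem _ _ (AffineSubspace.vsub_mem_direction (hk k h0) hsA)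
    have h5 : s - a ∈ A.direction :=
      (Submodule.smul_mem_iff _ (sub_ne_zero.2 hb.ne)).1 h4
    have h6 : a -ᵥ s ∈ A.direction := by
      rw [vsub_eq_sub, ← neg_sub]; exact Submodule.neg_mem _ h5
    exact (AffineSubspace.vsub_right_mem_direction_iff_mem hsA a).1 h6
  have hY : vectorSpan ℝ (Set.range y) ≤ vectorSpan ℝ Q :=
    vectorSpan_mono ℝ (by rintro _ ⟨k, rfl⟩; exact hSQ (hy k))
  have hfdY : FiniteDimensional ℝ (vectorSpan ℝ (Set.range y)) :=
    Submodule.finiteDimensional_of_le hY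
  have hfinY : Module.finrank ℝ (vectorSpan ℝ (Set.range y)) + 1 = d := by
    let k0 : Fin d := ⟨0, by omega⟩
    have hker : vectorSpan ℝ (Set.range y) ≤ L.ker := by
      rw [vectorSpan, Submodule.span_le]
      rintro _ ⟨_, ⟨k, rfl⟩, _, ⟨l, rfl⟩, rfl⟩
      simp [hLy]
    have hlt : vectorSpan ℝ (Set.range y) < vectorSpan ℝ Q := by
      refine lt_of_le_of_ne hY fun h => ?_
      have h1 : y k0 - a ∈ vectorSpan ℝ (Set.range y) := by
        rw [h]; exact hvs _ (hSQ (hy k0))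
      have h2 : L (y k0 - a) = 0 := hker h1
      rw [map_sub, hLy] at h2
      linarith
    have h1 := Submodule.finrank_lt_finrank_of_lt hlt
    have hle : vectorSpan ℝ Q ≤ vectorSpan ℝ (Set.range y) ⊔ Submodule.span ℝ {y k0 - a} := by
      intro w hw
      rw [hcoord w hw]
      refine Submodule.sum_mem _ fun k _ => Submodule.smul_mem _ _ ?_
      have : y k - a = (y k -ᵥ y k0) + (y k0 - a) := by simp
      rw [this]
      exact Submodule.add_mem_sup (vsub_mem_vectorSpan ℝ ⟨k, rfl⟩ ⟨k0, rfl⟩)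
        (Submodule.mem_span_singleton_self _)
    have h2 := Submodule.finrank_mono hle
    have h3 := Submodule.finrank_add_le_finrank_add_finrank (vectorSpan ℝ (Set.range y))
      (Submodule.span ℝ {y k0 - a})
    have h4 := finrank_span_le_card (R := ℝ) ({y k0 - a} : Set V)
    simp at h4
    omega
  have hins : insert a (S \ {a}) = S := by
    rw [Set.insert_sdiff_singleton, Set.insert_eq_of_mem ha]
  have hvsQ' : vectorSpan ℝ Q' = vectorSpan ℝ Q := by
    have h1 : a ∈ affineSpan ℝ (S \ {a}) :=
      hapex _ z hz hza hzy (subset_affineSpan ℝ _ ⟨hz, hza⟩)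
        (fun k _ => subset_affineSpan ℝ _ (hyS' k))
    rw [hQ'def, hQdef, bx_vs_hull, bx_vs_hull, ← direction_affineSpan,
      ← affineSpan_insert_eq_affineSpan ℝ h1, hins, direction_affineSpan]
  have hdim' : Module.finrank ℝ (vectorSpan ℝ Q') = d := by rw [hvsQ', hdim]
  refine ⟨hdim', fun F => ?_⟩
  constructor
  · intro hF
    obtain ⟨hFe, hFc, hFcl, hFn, hFd⟩ := (bx_facet_iff hd1).1 hF
    obtain ⟨h, c0, hh, hhi⟩ := bx_support hQ'c hFe hFc hFn hdim' hFd
    obtain ⟨p, hp⟩ := hFn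
    have hpQ' := hFe.subset hp
    have hhp : h p = c0 := (hhi p hpQ').2 hp
    have hnon : ¬ vectorSpan ℝ Q ≤ h.ker := by
      intro hk
      have : F = Q' := by
        refine Subset.antisymm hFe.subset fun q hq => (hhi q hq).1 ?_
        have h1 : h (q - p) = 0 := by
          refine hk ?_
          rw [← hvsQ']
          exact vsub_mem_vectorSpan ℝ hq hpQ'
        rw [map_sub] at h1; linarith
      rw [this] at hFd
      omega
    have hFker : vectorSpan ℝ F ≤ h.ker := by
      rw [vectorSpan, Submodule.span_le]
      rintro _ ⟨u, hu, v, hv, rfl⟩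
      have h1 := (hhi u (hFe.subset hu)).2 hu
      have h2 := (hhi v (hFe.subset hv)).2 hv
      simp [h1, h2]
    have hFY : F ⊆ convexHull ℝ (Set.range y) →
        vectorSpan ℝ F = vectorSpan ℝ (Set.range y) := by
      intro hsub
      refine Submodule.eq_of_le_of_finrank_le ?_ (by omega)
      rw [← bx_vs_hull (Set.range y)]
      exact vectorSpan_mono ℝ hsub
    by_cases hca : c0 ≤ h a
    · right
      have hhQ : ∀ q ∈ Q, c0 ≤ h q := by
        have : Q ⊆ {q | c0 ≤ h q} := by
          refine convexHull_min (fun s hs => ?_) (convex_halfSpace_ge h.isLinear _)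
          by_cases hsa : s = a
          · rw [hsa]; exact hca
          · exact hh s (hSQ' ⟨hs, hsa⟩)
        exact this
      have hGe := bx_exposed h c0 hhQ
      have hGc := bx_exposed_convex hQc h c0
      set G := {q | q ∈ Q ∧ h q = c0} with hG
      have hFG : F ⊆ G := fun q hq =>
        ⟨hQ'Q (hFe.subset hq), (hhi q (hFe.subset hq)).2 hq⟩
      have hFeq : F = convexHull ℝ ((S \ {a}) ∩ G) := by
        rw [bx_face_eq hFe hFc]
        congr 1
        ext s
        constructor
        · rintro ⟨hs, hsF⟩; exact ⟨hs, hFG hsF⟩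
        · rintro ⟨hs, hsG⟩; exact ⟨hs, (hhi s (hSQ' hs)).1 hsG.2⟩
      refine ⟨G, ?_, ?_, hFeq⟩
      · refine (bx_facet_iff hd1).2 ⟨hGe, hGc, ?_, ⟨p, hFG hp⟩, ?_⟩
        · rw [bx_face_eq hGe hGc]
          exact (hS.subset inter_subset_left).isClosed_convexHull ℝ
        · have hGQ : vectorSpan ℝ G ≤ vectorSpan ℝ Q := vectorSpan_mono ℝ hGe.subset
          have hfdG : FiniteDimensional ℝ (vectorSpan ℝ G) :=
            Submodule.finiteDimensional_of_le hGQ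
          have h1 := Submodule.finrank_mono (vectorSpan_mono ℝ hFG)
          have hGker : vectorSpan ℝ G ≤ h.ker := by
            rw [vectorSpan, Submodule.span_le]
            rintro _ ⟨u, hu, v, hv, rfl⟩
            simp [hu.2, hv.2]
          have hlt : vectorSpan ℝ G < vectorSpan ℝ Q :=
            lt_of_le_of_ne hGQ fun h2 => hnon (h2 ▸ hGker)
          have h2 := Submodule.finrank_lt_finrank_of_lt hlt
          omega
      · by_contra hcon
        push Not at hcon
        obtain ⟨haG, hall⟩ := hcon
        have hsub : F ⊆ convexHull ℝ (Set.range y) := by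
          rw [hFeq]
          exact convexHull_mono fun s hs => hall s hs.1.1 hs.2 hs.1.2
        have hW := hFY hsub
        apply hnon
        intro w hw
        rw [hcoord w hw]
        refine Submodule.sum_mem _ fun k _ => Submodule.smul_mem _ _ ?_
        have h1 : y k -ᵥ p ∈ h.ker := by
          apply hFker
          rw [hW, ← bx_vs_hull]
          exact vsub_mem_vectorSpan ℝ (subset_convexHull ℝ _ ⟨k, rfl⟩) (hsub hp)
        have h2 : h (y k - p) = 0 := h1
        have h3 : h a = c0 := haG.2
        rw [LinearMap.mem_ker, map_sub, h3, ← hhp, ← map_sub, h2]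
    · left
      push Not at hca
      have hsub : F ⊆ convexHull ℝ (Set.range y) := by
        intro q hq
        rw [← hYeq]
        have hqQ' := hFe.subset hq
        refine ⟨hqQ', le_antisymm ?_ (hLQ' q hqQ')⟩
        have hqQ := hQ'Q hqQ'
        have h1 : h (q - a) = ∑ k, c k (q - a) * (h (y k) - h a) := by
          conv_lhs => rw [hcoord _ (hvs q hqQ)]
          simp only [map_sum, map_smul, smul_eq_mul, map_sub h]
        have h2 : L (q - a) * (c0 - h a) ≤ h (q - a) := by
          rw [h1, hLapp, Finset.sum_mul]
          refine Finset.sum_le_sum fun k _ => mul_le_mul_of_nonneg_left ?_ (hc0 k q hqQ)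
          linarith [hh _ (hSQ' (hyS' k))]
        have h3 : h q = c0 := (hhi q hqQ').2 hq
        rw [map_sub h, h3] at h2
        have h4 : L (q - a) ≤ 1 := by
          by_contra h5
          push Not at h5
          nlinarith
        rw [map_sub] at h4
        linarith
      refine Subset.antisymm hsub fun q hq => ?_
      have hqQ' : q ∈ Q' := by
        rw [← hYeq] at hq; exact hq.1
      refine bx_mem_of_sub_mem hFe hFc hp hqQ' ?_
      rw [hFY hsub, ← bx_vs_hull]
      exact vsub_mem_vectorSpan ℝ hq (hsub hp)
  · rintro (rfl | ⟨G, hG, hcond, rfl⟩)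
    · refine (bx_facet_iff hd1).2 ⟨hYeq ▸ hYext, convex_convexHull ℝ _,
        (Set.finite_range y).isClosed_convexHull ℝ, ?_, ?_⟩
      · exact ⟨_, subset_convexHull ℝ _ ⟨⟨0, by omega⟩, rfl⟩⟩
      · rw [bx_vs_hull]; exact hfinY
    · obtain ⟨hGe, hGc, hGcl, hGn, hGd⟩ := (bx_facet_iff hd1).1 hG
      have hGeq := bx_face_eq hGe hGc
      have hFeq : Q' ∩ G = convexHull ℝ ((S \ {a}) ∩ G) := by
        rw [bx_face_eq (bx_restrict hGe hQ'Q) (hQ'c.inter hGc)]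
        congr 1
        ext s
        constructor
        · rintro ⟨hs, _, hsG⟩; exact ⟨hs, hsG⟩
        · rintro ⟨hs, hsG⟩; exact ⟨hs, hSQ' hs, hsG⟩
      have hspan : (convexHull ℝ ((S \ {a}) ∩ G)).Nonempty ∧
          vectorSpan ℝ (convexHull ℝ ((S \ {a}) ∩ G)) = vectorSpan ℝ G := by
        by_cases haG : a ∈ G
        · obtain ⟨s, hs, hsG, hsa, hsy⟩ := hcond.resolve_left (not_not.2 haG)
          obtain ⟨h, c0, hh, hhi⟩ := bx_support hQc hGe hGc hGn hdim hGd
          have hha := (hhi a (hSQ ha)).2 haG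
          have hhs := (hhi s (hSQ hs)).2 hsG
          have hkG : ∀ k, c k (s - a) ≠ 0 → y k ∈ G := by
            intro k hk
            refine (hhi _ (hSQ (hy k))).1 ?_
            have h1 : h (s - a) = ∑ k, c k (s - a) * (h (y k) - h a) := by
              conv_lhs => rw [hcoord _ (hvs s (hSQ hs))]
              simp only [map_sum, map_smul, smul_eq_mul, map_sub h]
            rw [map_sub h, hha, hhs, sub_self] at h1
            have h2 := (Finset.sum_eq_zero_iff_of_nonneg (fun l _ =>
              mul_nonneg (hc0 l s (hSQ hs))
                (by linarith [hh _ (hSQ (hy l))] : 0 ≤ h (y l) - c0))).1 h1.symm k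
                (Finset.mem_univ k)
            rcases mul_eq_zero.1 h2 with h3 | h3
            · exact absurd h3 hk
            · linarith
          have haA : a ∈ affineSpan ℝ ((S \ {a}) ∩ G) :=
            hapex _ s hs hsa hsy (subset_affineSpan ℝ _ ⟨⟨hs, hsa⟩, hsG⟩)
              (fun k hk => subset_affineSpan ℝ _ ⟨hyS' k, hkG k hk⟩)
          have hins' : insert a ((S \ {a}) ∩ G) = S ∩ G := by
            rw [Set.insert_inter_distrib, hins, Set.insert_eq_of_mem haG]
          refine ⟨⟨s, subset_convexHull ℝ _ ⟨⟨hs, hsa⟩, hsG⟩⟩, ?_⟩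
          conv_rhs => rw [hGeq]
          rw [bx_vs_hull, bx_vs_hull, ← direction_affineSpan,
            ← affineSpan_insert_eq_affineSpan ℝ haA, hins', direction_affineSpan]
        · have : (S \ {a}) ∩ G = S ∩ G := by
            ext s
            constructor
            · rintro ⟨hs, hsG⟩; exact ⟨hs.1, hsG⟩
            · rintro ⟨hs, hsG⟩
              exact ⟨⟨hs, fun h => haG (h ▸ hsG)⟩, hsG⟩
          rw [this, ← hGeq]
          exact ⟨hGn, rfl⟩
      refine (bx_facet_iff hd1).2 ⟨hFeq ▸ bx_restrict hGe hQ'Q, convex_convexHull ℝ _,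
        (hS.subset (inter_subset_left.trans sdiff_subset)).isClosed_convexHull ℝ,
        hspan.1, ?_⟩
      rw [hspan.2]; exact hGd

lemma bx_memT {d n : ℕ} {x : Fin (n + 1) → V} (hx : Function.Injective x) (hd : 1 ≤ d) {i : ℤ}
    (h0 : 0 ≤ i) (h1 : i ≤ (n : ℤ) - d + 1) (k : Fin (n + 1)) :
    x k ∈ Tset d x i ↔ i ≤ (k : ℤ) ∧ (k : ℤ) ≤ i + d - 1 := by
  have hk := k.2
  unfold Tset xc
  constructor
  · rintro ⟨t, ⟨ht1, ht2⟩, ht⟩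
    have := congrArg Fin.val (hx ht)
    simp only at this
    omega
  · rintro ⟨ha, hb⟩
    refine ⟨k, ⟨ha, hb⟩, ?_⟩
    refine congrArg x (Fin.ext ?_)
    simp only
    omega

lemma bx_memE {d n : ℕ} {x : Fin (n + 1) → V} (hx : Function.Injective x) (hd : 3 ≤ d) {j : ℤ}
    (h0 : 2 ≤ j) (h1 : j ≤ (n : ℤ)) (k : Fin (n + 1)) :
    x k ∈ Eset d x j ↔ (k : ℕ) = 0 ∨
      (j - ((d : ℤ) - 2) ≤ (k : ℤ) ∧ (k : ℤ) ≤ j + ((d : ℤ) - 2) ∧ (k : ℤ) ≠ j) ∨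
      ((k : ℕ) = n ∧ j = n) := by
  have hk := k.2
  unfold Eset xc
  constructor
  · rintro (h | ⟨t, ⟨⟨ht1, ht2⟩, ht3⟩, ht⟩)
    · left
      rw [hx h]; rfl
    · have := congrArg Fin.val (hx ht)
      simp only at this
      have ht3 : t ≠ j := ht3
      omega
  · rintro (h | ⟨ha, hb, hc⟩ | ⟨ha, hb⟩)
    · left
      refine congrArg x (Fin.ext ?_)
      simpa using h
    · right
      refine ⟨k, ⟨⟨ha, hb⟩, hc⟩, ?_⟩
      refine congrArg x (Fin.ext ?_)
      simp only
      omega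
    · right
      refine ⟨j + 1, ⟨⟨by omega, by omega⟩, ?_⟩, ?_⟩
      · simp
      · refine congrArg x (Fin.ext ?_)
        simp only
        omega

lemma bx_T_sub {d n : ℕ} (x : Fin (n + 1) → V) (i : ℤ) : Tset d x i ⊆ Set.range x := by
  rintro _ ⟨t, _, rfl⟩
  exact ⟨_, rfl⟩

lemma bx_E_sub {d n : ℕ} (x : Fin (n + 1) → V) (i : ℤ) : Eset d x i ⊆ Set.range x := by
  rintro _ (rfl | ⟨t, _, rfl⟩)
  · exact ⟨_, rfl⟩
  · exact ⟨_, rfl⟩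

lemma bx_set_ext {ι : Type*} {x : ι → V} {A B : Set V} (hA : A ⊆ Set.range x)
    (hB : B ⊆ Set.range x) (h : ∀ k, x k ∈ A ↔ x k ∈ B) : A = B := by
  ext s
  constructor
  · intro hs
    obtain ⟨k, rfl⟩ := hA hs
    exact (h k).1 hs
  · intro hs
    obtain ⟨k, rfl⟩ := hB hs
    exact (h k).2 hs

lemma bx_mem_hull {ι : Type*} {x : ι → V}
    (hext : ∀ i, x i ∈ Set.extremePoints ℝ (convexHull ℝ (Set.range x))) {A : Set V}
    (hA : A ⊆ Set.range x) (k : ι) : x k ∈ convexHull ℝ A ↔ x k ∈ A :=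
  ⟨fun h => extremePoints_convexHull_subset
      (inter_extremePoints_subset_extremePoints_of_subset (convexHull_mono hA) ⟨h, hext k⟩),
    fun h => subset_convexHull ℝ A h⟩

theorem bx_main (d m : ℕ) (hd : 3 ≤ d) (hn : d ≤ m) (x : Fin (m + 1 + 1) → V)
    (hx : IsBraxtope d (m + 1) x) :
    IsBraxtope d m (fun i : Fin (m + 1) => x i.castSucc) := by
  obtain ⟨-, hx⟩ := hx
  obtain ⟨-, hinj, hdim, hext, hfac⟩ := hx hd
  unfold braxQ at hdim hext hfac
  obtain ⟨-, hdim⟩ := bx_sdim.1 hdim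
  set x' : Fin (m + 1) → V := fun i => x i.castSucc with hx'
  have hinj' : Function.Injective x' := fun i j h => Fin.castSucc_injective _ (hinj h)
  have hx'app : ∀ k, x' k = x k.castSucc := fun k => rfl
  set a := x (Fin.last (m + 1)) with ha
  have hS' : Set.range x \ {a} = Set.range x' := by
    ext s
    constructor
    · rintro ⟨⟨k, rfl⟩, hk⟩
      have hk' : k ≠ Fin.last (m + 1) := fun h => hk (by rw [h]; rfl)
      exact ⟨k.castPred hk', by simp [hx']⟩
    · rintro ⟨k, rfl⟩
      refine ⟨⟨_, rfl⟩, fun h => ?_⟩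
      exact (Fin.castSucc_lt_last k).ne (hinj h)
  -- membership in the facets
  have hT : ∀ i : ℤ, 0 ≤ i → i ≤ ((m + 1 : ℕ) : ℤ) - d + 1 → ∀ k, x k ∈ convexHull ℝ (Tset d x i) ↔
      i ≤ (k : ℤ) ∧ (k : ℤ) ≤ i + d - 1 := fun i h0 h1 k => by
    rw [bx_mem_hull hext (bx_T_sub x i), bx_memT hinj (by omega) h0 h1]
  have hE : ∀ j : ℤ, 2 ≤ j → j ≤ ((m + 1 : ℕ) : ℤ) → ∀ k, x k ∈ convexHull ℝ (Eset d x j) ↔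
      ((k : ℕ) = 0 ∨
      (j - ((d : ℤ) - 2) ≤ (k : ℤ) ∧ (k : ℤ) ≤ j + ((d : ℤ) - 2) ∧ (k : ℤ) ≠ j) ∨
      ((k : ℕ) = m + 1 ∧ j = (m + 1 : ℕ))) := fun j h0 h1 k => by
    rw [bx_mem_hull hext (bx_E_sub x j), bx_memE hinj hd h0 h1]
  -- neighbours of the last vertex
  let yi : Fin d → Fin (m + 1) := fun k =>
    ⟨if (k : ℕ) = 0 then 0 else m + 1 - d + k, by have := k.2; split_ifs <;> omega⟩
  let y : Fin d → V := fun k => x' (yi k)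
  have hyi : ∀ k : Fin d, ((yi k : ℕ) = if (k : ℕ) = 0 then 0 else m + 1 - d + k) := fun k => rfl
  have hyr : ∀ k : Fin (m + 1), x' k ∈ Set.range y ↔ (k : ℕ) = 0 ∨ m + 1 - d + 1 ≤ (k : ℕ) := by
    intro k
    have hk := k.2
    constructor
    · rintro ⟨l, hl⟩
      have h1 := congrArg Fin.val (hinj' hl)
      rw [hyi] at h1
      split_ifs at h1 <;> omega
    · rintro (h | h)
      · refine ⟨⟨0, by omega⟩, congrArg x' (Fin.ext ?_)⟩
        rw [hyi]; simp [h]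
      · refine ⟨⟨(k : ℕ) - (m + 1 - d), by omega⟩, congrArg x' (Fin.ext ?_)⟩
        rw [hyi]
        simp only
        split_ifs <;> omega
  have hyrsub : Set.range y ⊆ Set.range x' := by
    rintro _ ⟨k, rfl⟩; exact ⟨_, rfl⟩
  let Φ : Fin d → Set V := fun k =>
    if (k : ℕ) = 0 then convexHull ℝ (Tset d x ((m : ℤ) + 2 - d))
    else if (k : ℕ) = 1 then convexHull ℝ (Eset d x ((m : ℤ) + 1))
    else convexHull ℝ (Eset d x ((m : ℤ) + 1 - d + k))
  have hΦf : ∀ k, IsFacetOf d (convexHull ℝ (Set.range x)) (Φ k) := by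
    intro k
    have hk := k.2
    rw [hfac]
    simp only [Φ]
    split_ifs
    · left; exact ⟨_, by omega, by omega, rfl⟩
    · right; exact ⟨_, by omega, by omega, rfl⟩
    · right; exact ⟨_, by omega, by omega, rfl⟩
  have hΦa : ∀ k, a ∈ Φ k := by
    intro k
    have hk := k.2
    simp only [Φ, ha]
    split_ifs
    · rw [hT _ (by omega) (by omega)]; simp only [Fin.val_last, true_and]; omega
    · rw [hE _ (by omega) (by omega)]; simp only [Fin.val_last, true_and]; omega
    · rw [hE _ (by omega) (by omega)]; simp only [Fin.val_last, true_and]; omega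
  have hΦy : ∀ k l, y l ∈ Φ k ↔ k ≠ l := by
    intro k l
    have hk := k.2
    have hl := l.2
    have hyl := hyi l
    have hkl : k ≠ l ↔ (k : ℕ) ≠ l := by rw [Ne, Fin.ext_iff]
    rw [hkl]
    simp only [Φ, y, hx'app]
    split_ifs at hyl ⊢
    all_goals first
      | rw [hT _ (by omega) (by omega)]; simp only [Fin.val_castSucc]; omega
      | rw [hE _ (by omega) (by omega)]; simp only [Fin.val_castSucc]; omega
  have hz0 : m + 1 - d < m + 1 := by omega
  have hyne : ∀ k, y k ≠ a := by
    intro k h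
    have := hS'.symm ▸ hyrsub ⟨k, rfl⟩
    exact this.2 h
  have hzr : x' ⟨m + 1 - d, hz0⟩ ∈ Set.range x \ {a} := hS' ▸ ⟨_, rfl⟩
  obtain ⟨hdim', hfac'⟩ := bx_abstract (by omega) (Set.finite_range x) hdim
    (by rintro _ ⟨k, rfl⟩; exact hext k) ⟨Fin.last (m + 1), rfl⟩ y
    (fun k => ⟨_, rfl⟩) hyne Φ hΦf hΦa (fun k l h => (hΦy k l).2 h)
    (fun k h => (hΦy k k).1 h rfl) (z := x' ⟨m + 1 - d, hz0⟩) hzr.1 hzr.2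
    (by rw [hyr]; simp only; omega)
  change Module.finrank ℝ (vectorSpan ℝ (convexHull ℝ (Set.range x \ {a}))) = d at hdim'
  change ∀ F : Set V, IsFacetOf d (convexHull ℝ (Set.range x \ {a})) F ↔ _ at hfac'
  have hsub : Set.range x' ⊆ Set.range x := by rw [← hS']; exact sdiff_subset
  have hcap : ∀ G : Set V, (Set.range x \ {a}) ∩ G ⊆ Set.range x' := fun G => by
    rw [hS']; exact inter_subset_left
  -- comparison of the vertex sets
  have hTeq : ∀ i : ℤ, 0 ≤ i → i ≤ (m : ℤ) - d + 1 →
      Tset d x' i = (Set.range x \ {a}) ∩ convexHull ℝ (Tset d x i) := by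
    intro i h0 h1
    refine bx_set_ext (bx_T_sub x' i) (hcap _) fun k => ?_
    rw [bx_memT hinj' (by omega) h0 h1, hS', mem_inter_iff, hx'app, hT i h0 (by omega)]
    simp only [Fin.val_castSucc]
    exact ⟨fun h => ⟨⟨k, rfl⟩, h⟩, fun h => h.2⟩
  have hEeq : ∀ j : ℤ, 2 ≤ j → j ≤ (m : ℤ) - 1 →
      Eset d x' j = (Set.range x \ {a}) ∩ convexHull ℝ (Eset d x j) := by
    intro j h0 h1
    refine bx_set_ext (bx_E_sub x' j) (hcap _) fun k => ?_
    have hk := k.2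
    rw [bx_memE hinj' hd h0 (by omega), hS', mem_inter_iff, hx'app, hE j h0 (by omega)]
    simp only [Fin.val_castSucc]
    exact ⟨fun h => ⟨⟨k, rfl⟩, by omega⟩, fun h => by have := h.2; omega⟩
  have hYeq : Eset d x' (m : ℤ) = Set.range y := by
    refine bx_set_ext (bx_E_sub x' _) hyrsub fun k => ?_
    have hk := k.2
    rw [bx_memE hinj' hd (by omega) le_rfl, hyr]
    omega
  -- the condition on the facets of the big polytope
  have hcondT : ∀ i : ℤ, 0 ≤ i → i ≤ ((m + 1 : ℕ) : ℤ) - d + 1 →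
      ((a ∉ convexHull ℝ (Tset d x i) ∨ ∃ z ∈ Set.range x, z ∈ convexHull ℝ (Tset d x i) ∧
        z ≠ a ∧ z ∉ Set.range y) ↔ i ≤ (m : ℤ) - d + 1) := by
    intro i h0 h1
    constructor
    · rintro (h | ⟨z, hz, hzT, hza, hzy⟩)
      · rw [ha, hT i h0 h1] at h
        simp only [Fin.val_last, true_and] at h
        omega
      · have hz' : z ∈ Set.range x' := hS' ▸ ⟨hz, hza⟩
        obtain ⟨k, rfl⟩ := hz'
        have hk := k.2
        rw [hyr] at hzy
        rw [hx'app, hT i h0 h1] at hzT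
        simp only [Fin.val_castSucc] at hzT
        omega
    · intro h
      left
      rw [ha, hT i h0 h1]
      simp only [Fin.val_last, true_and]
      omega
  have hcondE : ∀ j : ℤ, 2 ≤ j → j ≤ ((m + 1 : ℕ) : ℤ) →
      ((a ∉ convexHull ℝ (Eset d x j) ∨ ∃ z ∈ Set.range x, z ∈ convexHull ℝ (Eset d x j) ∧
        z ≠ a ∧ z ∉ Set.range y) ↔ j ≤ (m : ℤ) - 1) := by
    intro j h0 h1
    constructor
    · rintro (h | ⟨z, hz, hzT, hza, hzy⟩)
      · rw [ha, hE j h0 h1] at h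
        simp only [Fin.val_last, true_and] at h
        omega
      · have hz' : z ∈ Set.range x' := hS' ▸ ⟨hz, hza⟩
        obtain ⟨k, rfl⟩ := hz'
        have hk := k.2
        rw [hyr] at hzy
        rw [hx'app, hE j h0 h1] at hzT
        simp only [Fin.val_castSucc] at hzT
        omega
    · intro h
      by_cases hj : j + ((d : ℤ) - 2) ≤ m
      · left
        rw [ha, hE j h0 h1]
        simp only [Fin.val_last, true_and]
        omega
      · right
        refine ⟨_, hzr.1, ?_, hzr.2, ?_⟩
        · rw [hx'app, hE j h0 h1]
          simp only [Fin.val_castSucc]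
          omega
        · rw [hyr]; simp only; omega
  rw [hS'] at hdim' hfac' hTeq hEeq
  refine ⟨fun h => by omega, fun _ => ⟨hn, hinj', ?_, ?_, ?_⟩⟩
  · exact bx_sdim.2 ⟨⟨x' 0, subset_convexHull ℝ _ ⟨0, rfl⟩⟩, hdim'⟩
  · intro i
    exact inter_extremePoints_subset_extremePoints_of_subset (convexHull_mono hsub)
      ⟨subset_convexHull ℝ _ ⟨i, rfl⟩, hext _⟩
  · intro F
    unfold braxQ
    rw [hfac']
    constructor
    · rintro (h | ⟨G, hG, hcond, rfl⟩)
      · right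
        exact ⟨m, by omega, le_rfl, by rw [hYeq]; exact h⟩
      · rcases (hfac G).1 hG with ⟨i, h0, h1, rfl⟩ | ⟨j, h0, h1, rfl⟩
        · left
          have h2 := (hcondT i h0 h1).1 hcond
          exact ⟨i, h0, h2, by rw [hTeq i h0 h2]⟩
        · right
          have h2 := (hcondE j h0 h1).1 hcond
          exact ⟨j, h0, by omega, by rw [hEeq j h0 h2]⟩
    · rintro (⟨i, h0, h1, rfl⟩ | ⟨j, h0, h1, rfl⟩)
      · right
        refine ⟨_, (hfac _).2 (Or.inl ⟨i, h0, by omega, rfl⟩),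
          (hcondT i h0 (by omega)).2 h1, by rw [hTeq i h0 h1]⟩
      · by_cases hj : j = m
        · left
          rw [hj, hYeq]
        · right
          refine ⟨_, (hfac _).2 (Or.inr ⟨j, h0, by omega, rfl⟩),
            (hcondE j h0 (by omega)).2 (by omega), by rw [hEeq j h0 (by omega)]⟩

/-- Removing the last vertex of a `d`-braxtope `Q^{d,n}` (`n ≥ d + 1 ≥ 4`)
yields the `d`-braxtope `Q^{d,n-1}` on `x_0 < x_1 < ⋯ < x_{n-1}`. -/
theorem braxtope_delete_last_vertex (d n : ℕ) (hd : 3 ≤ d) (hn : d + 1 ≤ n)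
    (x : Fin (n + 1) → V) (hx : IsBraxtope d n x) :
    IsBraxtope d (n - 1)
      (fun i : Fin (n - 1 + 1) => x (Fin.castLE (by omega) i)) := by
  obtain ⟨m, rfl⟩ : ∃ m, n = m + 1 := ⟨n - 1, by omega⟩
  exact bx_main d m hd (by omega) x hx
end
end
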